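/- There exists a universal constant C > 0 (independent of N) such that for every N > 0, every choice of sign ±, and every Schwartz function f on ℝ × ℝ³, the function v(t,x) = ∫_0^t ( ∫_{ℝ³} exp(i x·ξ ± i (t−t') N |ξ_h|/|ξ|) (𝓕_x f(t',·))(ξ) dξ ) dt' satisfies ‖v‖_{L⁶(ℝ_t × ℝ³_x)} ≤ C N^{−1/6} ∫_ℝ ‖f(t',·)‖_{Ḣ¹} dt'. -/

import Mathlib

open MeasureTheory Complex
open scoped ENNReal RealInnerProductSpace

noncomputable section

/-- Fourier transform `f̂(ξ) = ∫ e^{-i x·ξ} f(x) dx` on `ℝⁿ`. -/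
def fourierTf {n : ℕ} (f : EuclideanSpace ℝ (Fin n) → ℂ) (ξ : EuclideanSpace ℝ (Fin n)) : ℂ :=
  ∫ x : EuclideanSpace ℝ (Fin n), Complex.exp (-Complex.I * Complex.ofReal ⟪x, ξ⟫) * f x

/-- Homogeneous Sobolev norm `‖f‖_{Ḣˢ}` on `ℝⁿ`. -/
def sobolevNorm {n : ℕ} (s : ℝ) (f : EuclideanSpace ℝ (Fin n) → ℂ) : ℝ :=
  (∫ ξ : EuclideanSpace ℝ (Fin n), ‖ξ‖ ^ (2 * s) * ‖fourierTf f ξ‖ ^ 2) ^ (1 / 2 : ℝ)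

/-- The stratification dispersion relation `|ξ_h| / |ξ|`. -/
def pStrat (ξ : EuclideanSpace ℝ (Fin 3)) : ℝ :=
  Real.sqrt ((ξ 0) ^ 2 + (ξ 1) ^ 2) / ‖ξ‖


lemma strip_line {D : Set (ℝ × ℝ)} {F : ℝ × ℝ → ℝ}
    (hSC : ∀ z ∈ D, ∀ w ∈ D, ∀ θ : ℝ, 0 ≤ θ → θ ≤ 1 → (1 - θ) • z + θ • w ∈ D ∧
      F ((1 - θ) • z + θ • w) ≤ (1 - θ) * F z + θ * F w
        - θ * (1 - θ) * ((w.1 - z.1) ^ 2 + (w.2 - z.2) ^ 2) / 2)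
    {z0 : ℝ × ℝ} (hz0 : z0 ∈ D) (hmin : ∀ z ∈ D, F z0 ≤ F z)
    {w : ℝ × ℝ} (hw : w ∈ D) {θ : ℝ} (h0 : 0 ≤ θ) (h1 : θ ≤ 1) :
    F ((1 - θ) • z0 + θ • w) ≤ F w
      - (1 - θ ^ 2) * ((w.1 - z0.1) ^ 2 + (w.2 - z0.2) ^ 2) / 2 := by
  set d := (w.1 - z0.1) ^ 2 + (w.2 - z0.2) ^ 2 with hd
  have hd0 : 0 ≤ d := by positivity
  have key : F z0 + d / 2 ≤ F w := by
    by_contra! hcon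
    have hstep : ∀ ε : ℝ, 0 < ε → ε ≤ 1 → F z0 ≤ F w - (1 - ε) * d / 2 := by
      intro ε he he1
      obtain ⟨hm, hi⟩ := hSC z0 hz0 w hw ε he.le he1
      have := hmin _ hm
      rw [← hd] at hi
      have h2 : ε * F z0 ≤ ε * (F w - (1 - ε) * d / 2) := by nlinarith
      exact le_of_mul_le_mul_left h2 he
    set g := F z0 + d / 2 - F w with hg
    have hg0 : 0 < g := by linarith
    have := hstep (min 1 (g / (d + 1))) (by positivity) (min_le_left _ _)
    have h3 : min 1 (g / (d + 1)) ≤ g / (d + 1) := min_le_right _ _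
    have h4 : min 1 (g / (d + 1)) * d ≤ g := by
      calc _ ≤ g / (d + 1) * d := by gcongr
        _ ≤ g := by
          rw [div_mul_eq_mul_div, div_le_iff₀ (by positivity)]; nlinarith
    nlinarith
  obtain ⟨-, hi⟩ := hSC z0 hz0 w hw θ h0 h1
  rw [← hd] at hi
  nlinarith [mul_nonneg (sub_nonneg.2 h1) (sub_nonneg.2 key)]

lemma lintegral_r_le {Q : Set ℝ} {δ : ℝ} (hδ : 0 ≤ δ) (hQ0 : ∀ r ∈ Q, 0 < r)
    (hQ : ∀ r ∈ Q, ∀ r' ∈ Q, r ≤ r' → (r' ^ 2 - r ^ 2) / 2 ≤ δ) :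
    ∫⁻ r : ℝ, Q.indicator (fun r => ENNReal.ofReal r) r ≤ ENNReal.ofReal δ := by
  rcases Q.eq_empty_or_nonempty with rfl | ⟨q, hq⟩
  · simp
  set r0 := sInf Q
  have hbdd : BddBelow Q := ⟨0, fun r hr => (hQ0 r hr).le⟩
  have hr0 : 0 ≤ r0 := le_csInf ⟨q, hq⟩ (fun r hr => (hQ0 r hr).le)
  set r1 := Real.sqrt (r0 ^ 2 + 2 * δ)
  have hr01 : r0 ≤ r1 := by
    apply Real.le_sqrt_of_sq_le; linarith
  have hsub : Q ⊆ Set.Icc r0 r1 := by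
    intro r hr
    refine ⟨csInf_le hbdd hr, ?_⟩
    apply Real.le_sqrt_of_sq_le
    have hle : Real.sqrt (r ^ 2 - 2 * δ) ≤ r0 := by
      apply le_csInf ⟨q, hq⟩
      intro s hs
      rw [Real.sqrt_le_iff]
      refine ⟨(hQ0 s hs).le, ?_⟩
      rcases le_total s r with h | h
      · have := hQ s hs r hr h; linarith
      · have := hQ0 r hr; nlinarith
    rcases le_total 0 (r ^ 2 - 2 * δ) with h | h
    · have h5 := Real.sq_sqrt h
      have h6 := Real.sqrt_nonneg (r ^ 2 - 2 * δ)
      nlinarith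
    · nlinarith
  calc ∫⁻ r : ℝ, Q.indicator (fun r => ENNReal.ofReal r) r
      ≤ ∫⁻ r : ℝ, (Set.Icc r0 r1).indicator (fun r => ENNReal.ofReal r) r := by
        apply lintegral_mono
        intro r
        exact Set.indicator_le_indicator_of_subset hsub (fun _ => by positivity) r
    _ = ∫⁻ r in Set.Icc r0 r1, ENNReal.ofReal r := by
        rw [lintegral_indicator measurableSet_Icc]
    _ = ENNReal.ofReal (∫ r in Set.Icc r0 r1, r) := by
        rw [ofReal_integral_eq_lintegral_ofReal]
        · exact (continuous_id.integrableOn_Icc)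
        · filter_upwards [ae_restrict_mem measurableSet_Icc] with r hr
          exact hr0.trans hr.1
    _ = ENNReal.ofReal δ := by
        rw [integral_Icc_eq_integral_Ioc, ← intervalIntegral.integral_of_le hr01, integral_id]
        congr 1
        rw [Real.sq_sqrt (by positivity)]; ring

lemma vol_strip {D : Set (ℝ × ℝ)} {F : ℝ × ℝ → ℝ} (hD : IsCompact D) (hF : ContinuousOn F D)
    (hSC : ∀ z ∈ D, ∀ w ∈ D, ∀ θ : ℝ, 0 ≤ θ → θ ≤ 1 → (1 - θ) • z + θ • w ∈ D ∧
      F ((1 - θ) • z + θ • w) ≤ (1 - θ) * F z + θ * F w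
        - θ * (1 - θ) * ((w.1 - z.1) ^ 2 + (w.2 - z.2) ^ 2) / 2)
    (a δ : ℝ) (hδ : 0 ≤ δ) :
    volume (D ∩ F ⁻¹' Set.Icc a (a + δ)) ≤ ENNReal.ofReal (2 * Real.pi * δ) := by
  rcases D.eq_empty_or_nonempty with rfl | hne
  · simp
  obtain ⟨z0, hz0, hmin⟩ := hD.exists_isMinOn hne hF
  have hmin' : ∀ z ∈ D, F z0 ≤ F z := fun z hz => hmin hz
  set E := D ∩ F ⁻¹' Set.Icc a (a + δ) with hE
  have hEm : MeasurableSet E :=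
    (hF.preimage_isClosed_of_isClosed hD.isClosed isClosed_Icc).measurableSet
  set E' := (fun z => z0 + z) ⁻¹' E with hE'
  have hE'm : MeasurableSet E' := (measurable_const_add z0) hEm
  have h1 : volume E = volume E' := (measure_preimage_add volume z0 E).symm
  rw [h1, ← lintegral_indicator_one hE'm, ← lintegral_comp_polarCoord_symm]
  have htar : polarCoord.target = Set.Ioi (0 : ℝ) ×ˢ Set.Ioo (-Real.pi) Real.pi := rfl
  rw [htar, Measure.volume_eq_prod, ← Measure.prod_restrict, lintegral_prod_symm]
  · calc ∫⁻ θ in Set.Ioo (-Real.pi) Real.pi, ∫⁻ r in Set.Ioi (0:ℝ),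
          ENNReal.ofReal r • E'.indicator (1 : ℝ × ℝ → ℝ≥0∞) (polarCoord.symm (r, θ))
        ≤ ∫⁻ θ in Set.Ioo (-Real.pi) Real.pi, ENNReal.ofReal δ := by
          apply lintegral_mono
          intro θ
          set Q : Set ℝ := {r | 0 < r ∧ polarCoord.symm (r, θ) ∈ E'}
          calc _ ≤ ∫⁻ r : ℝ, Q.indicator (fun r => ENNReal.ofReal r) r := by
                beta_reduce
                rw [← lintegral_indicator measurableSet_Ioi]
                apply lintegral_mono
                intro r
                by_cases hr : 0 < r
                · by_cases hr2 : polarCoord.symm (r, θ) ∈ E'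
                  · have : r ∈ Q := ⟨hr, hr2⟩
                    rw [Set.indicator_of_mem this, Set.indicator_of_mem (by exact hr)]
                    rw [Set.indicator_of_mem hr2]; simp
                  · rw [Set.indicator_of_mem (by exact hr)]
                    rw [Set.indicator_of_notMem hr2]; simp
                · rw [Set.indicator_of_notMem (by exact hr)]; simp
            _ ≤ _ := by
              apply lintegral_r_le hδ (fun r hr => hr.1)
              rintro r ⟨hr, hrE⟩ r' ⟨hr', hrE'⟩ hle
              have hx : z0 + polarCoord.symm (r', θ) ∈ D := hrE'.1
              have hxF : F (z0 + polarCoord.symm (r', θ)) ≤ a + δ := hrE'.2.2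
              have hyF : a ≤ F (z0 + polarCoord.symm (r, θ)) := hrE.2.1
              have := strip_line hSC hz0 hmin' hx (θ := r / r') (by positivity)
                ((div_le_one hr').2 hle)
              have heq : (1 - r / r') • z0 + (r / r') • (z0 + polarCoord.symm (r', θ))
                  = z0 + polarCoord.symm (r, θ) := by
                ext <;> simp [polarCoord] <;> field_simp <;> ring
              rw [heq] at this
              simp only [polarCoord_symm_apply, Prod.fst_add, Prod.snd_add, add_sub_cancel_left,
                mul_pow, ← mul_add, Real.cos_sq_add_sin_sq] at this
              simp only [polarCoord_symm_apply] at hxF hyF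
              have e2 : (1 - (r / r') ^ 2) * (r' ^ 2 * 1) = r' ^ 2 - r ^ 2 := by
                field_simp
              rw [e2] at this
              linarith
      _ = ENNReal.ofReal (2 * Real.pi * δ) := by
          rw [lintegral_const]
          simp only [Measure.restrict_apply_univ, Real.volume_Ioo]
          rw [← ENNReal.ofReal_mul hδ]; congr 1; ring
  · apply Measurable.aemeasurable
    simp only [smul_eq_mul]
    apply Measurable.mul (by fun_prop)
    exact (measurable_one.indicator hE'm).comp continuous_polarCoord_symm.measurable

lemma vol_strip_scaled {D : Set (ℝ × ℝ)} {F : ℝ × ℝ → ℝ} (hD : IsCompact D)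
    (hF : ContinuousOn F D) {α β : ℝ} (hα : 0 < α) (hβ : 0 < β)
    (hSC : ∀ z ∈ D, ∀ w ∈ D, ∀ θ : ℝ, 0 ≤ θ → θ ≤ 1 → (1 - θ) • z + θ • w ∈ D ∧
      F ((1 - θ) • z + θ • w) ≤ (1 - θ) * F z + θ * F w
        - θ * (1 - θ) * (((w.1 - z.1) / α) ^ 2 + ((w.2 - z.2) / β) ^ 2) / 2)
    (a δ : ℝ) (hδ : 0 ≤ δ) :
    volume (D ∩ F ⁻¹' Set.Icc a (a + δ)) ≤ ENNReal.ofReal (2 * Real.pi * δ * α * β) := by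
  set g : ℝ × ℝ → ℝ × ℝ := Prod.map (α * ·) (β * ·) with hg
  have hgc : Continuous g := by fun_prop
  have hE : MeasurableSet (D ∩ F ⁻¹' Set.Icc a (a + δ)) :=
    (hF.preimage_isClosed_of_isClosed hD.isClosed isClosed_Icc).measurableSet
  have hmap : Measure.map g volume = ENNReal.ofReal (α⁻¹ * β⁻¹) • (volume : Measure (ℝ × ℝ)) := by
    rw [Measure.volume_eq_prod, hg, ← Measure.map_prod_map _ _ (by fun_prop) (by fun_prop),
      Real.map_volume_mul_left hα.ne', Real.map_volume_mul_left hβ.ne',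
      Measure.prod_smul_left, Measure.prod_smul_right, smul_smul, abs_of_pos (inv_pos.2 hα),
      abs_of_pos (inv_pos.2 hβ), ENNReal.ofReal_mul (inv_pos.2 hα).le]
  have hv : volume (g ⁻¹' (D ∩ F ⁻¹' Set.Icc a (a + δ))) ≤ ENNReal.ofReal (2 * Real.pi * δ) := by
    rw [Set.preimage_inter, ← Set.preimage_comp]
    apply vol_strip (D := g ⁻¹' D) _ (hF.comp hgc.continuousOn (fun _ h => h)) _ a δ hδ
    · have : g ⁻¹' D = (Prod.map (α⁻¹ * ·) (β⁻¹ * ·)) '' D := by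
        ext z
        constructor
        · intro hz
          refine ⟨g z, hz, ?_⟩
          ext <;> simp [hg] <;> field_simp
        · rintro ⟨w, hw, rfl⟩
          have : g (Prod.map (α⁻¹ * ·) (β⁻¹ * ·) w) = w := by
            ext <;> simp [hg] <;> field_simp
          rw [Set.mem_preimage, this]; exact hw
      rw [this]
      exact hD.image (by fun_prop)
    · intro z hz w hw θ h0 h1
      have := hSC (g z) hz (g w) hw θ h0 h1
      have e : g ((1 - θ) • z + θ • w) = (1 - θ) • g z + θ • g w := by
        ext <;> simp [hg] <;> ring
      refine ⟨by rw [Set.mem_preimage, e]; exact this.1, ?_⟩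
      simp only [Function.comp, e]
      refine this.2.trans (le_of_eq ?_)
      simp only [hg, Prod.map_fst, Prod.map_snd]
      have e1 : (α * w.1 - α * z.1) / α = w.1 - z.1 := by field_simp
      have e2 : (β * w.2 - β * z.2) / β = w.2 - z.2 := by field_simp
      rw [e1, e2]
  rw [← Measure.map_apply hgc.measurable hE, hmap, Measure.smul_apply, smul_eq_mul] at hv
  calc _ = ENNReal.ofReal (α * β) * (ENNReal.ofReal (α⁻¹ * β⁻¹) *
        volume (D ∩ F ⁻¹' Set.Icc a (a + δ))) := by
        rw [← mul_assoc, ← ENNReal.ofReal_mul (by positivity)]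
        have : α * β * (α⁻¹ * β⁻¹) = 1 := by field_simp
        rw [this]; simp
    _ ≤ ENNReal.ofReal (α * β) * ENNReal.ofReal (2 * Real.pi * δ) := by gcongr
    _ = _ := by rw [← ENNReal.ofReal_mul (by positivity)]; congr 1; ring



abbrev E3 := EuclideanSpace ℝ (Fin 3)

/-- The vector with coordinates `(s, y.1, y.2)`. -/
def vec3 (v : ℝ × (ℝ × ℝ)) : E3 := !₂[v.1, v.2.1, v.2.2]

lemma vec3_mp : MeasurePreserving vec3 := by
  have h1 := (volume_preserving_piFinSuccAbove (fun _ : Fin 3 => ℝ) 0).symm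
  have h2 := (volume_preserving_finTwoArrow ℝ).symm
  have h3 := (MeasurePreserving.id (volume : Measure ℝ)).prod h2
  have h4 := (PiLp.volume_preserving_toLp (Fin 3)).comp (h1.comp h3)
  rw [← Measure.volume_eq_prod] at h4
  convert h4 using 1
  ext v i
  fin_cases i
  · simp [vec3, Function.comp]
  · simp [vec3, Function.comp]
  · simp [vec3, Function.comp]

lemma vec3_add (v w : ℝ × (ℝ × ℝ)) : vec3 (v + w) = vec3 v + vec3 w := by
  ext i; fin_cases i <;> simp [vec3]

lemma vec3_sub (v w : ℝ × (ℝ × ℝ)) : vec3 (v - w) = vec3 v - vec3 w := by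
  ext i; fin_cases i <;> simp [vec3]

lemma norm_vec3 (v : ℝ × (ℝ × ℝ)) : ‖vec3 v‖ = Real.sqrt (v.1 ^ 2 + v.2.1 ^ 2 + v.2.2 ^ 2) := by
  rw [EuclideanSpace.norm_eq, Fin.sum_univ_three]; simp [vec3]

lemma vec3_surj (x : E3) : ∃ v, vec3 v = x :=
  ⟨(x 0, x 1, x 2), by ext i; fin_cases i <;> simp [vec3]⟩

lemma vec3_cont : Continuous vec3 := by
  unfold vec3; fun_prop


lemma mp_rearrange {A B C D : Type*} [MeasureSpace A] [MeasureSpace B] [MeasureSpace C]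
    [MeasureSpace D] [SigmaFinite (volume : Measure A)] [SigmaFinite (volume : Measure B)]
    [SigmaFinite (volume : Measure C)] [SigmaFinite (volume : Measure D)] :
    MeasurePreserving (fun v : (A × B) × (C × D) => ((v.1.1, v.2.1), (v.1.2, v.2.2))) := by
  have h1 := volume_preserving_prodAssoc (α₁ := A) (β₁ := B) (γ₁ := C × D)
  have h2 := (MeasurePreserving.id (volume : Measure A)).prod
    (volume_preserving_prodAssoc (α₁ := B) (β₁ := C) (γ₁ := D)).symm
  have h3 := (MeasurePreserving.id (volume : Measure A)).prod
    ((Measure.measurePreserving_swap (μ := (volume : Measure B)) (ν := (volume : Measure C))).prod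
      (MeasurePreserving.id (volume : Measure D)))
  have h4 := (MeasurePreserving.id (volume : Measure A)).prod
    (volume_preserving_prodAssoc (α₁ := C) (β₁ := B) (γ₁ := D))
  have h5 := (volume_preserving_prodAssoc (α₁ := A) (β₁ := C) (γ₁ := B × D)).symm
  exact h5.comp (h4.comp (h3.comp (h2.comp h1)))

/-- `P` is strongly convex along the direction `L e₀` in the closed set `S`. -/
structure GoodCone (P : E3 → ℝ) (S : Set E3) (L : E3 ≃ₗᵢ[ℝ] E3) (c : ℝ) : Prop where
  closed : IsClosed S
  cont : ∀ y, ContinuousOn (fun s => P (L (vec3 (s, y)))) {s | L (vec3 (s, y)) ∈ S}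
  sc : ∀ R : ℝ, 0 < R → ∀ y s s', L (vec3 (s, y)) ∈ S → L (vec3 (s', y)) ∈ S →
    ‖L (vec3 (s, y))‖ ≤ R → ‖L (vec3 (s', y))‖ ≤ R → ∀ θ : ℝ, 0 ≤ θ → θ ≤ 1 →
    L (vec3 ((1 - θ) * s + θ * s', y)) ∈ S ∧
    P (L (vec3 ((1 - θ) * s + θ * s', y))) ≤ (1 - θ) * P (L (vec3 (s, y)))
      + θ * P (L (vec3 (s', y))) - θ * (1 - θ) * ((s' - s) / (R / c)) ^ 2 / 2

lemma slice2 {P : E3 → ℝ} {S : Set E3} {L : E3 ≃ₗᵢ[ℝ] E3} {c : ℝ} (hc : 0 < c)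
    (hG : GoodCone P S L c) {R1 R2 R3 : ℝ} (hR1 : 0 < R1) (hR2 : 0 < R2) (hR3 : 0 < R3)
    (v0 : ℝ × (ℝ × ℝ)) (y2 y3 : ℝ × ℝ) (a δ : ℝ) (hδ : 0 ≤ δ) :
    volume ({z : ℝ × ℝ | ((L (vec3 (z.1, y2)) ∈ S ∧ ‖L (vec3 (z.1, y2))‖ ≤ R2) ∧
      (L (vec3 (z.2, y3)) ∈ S ∧ ‖L (vec3 (z.2, y3))‖ ≤ R3)) ∧
      (L (vec3 (v0.1 - z.1 - z.2, v0.2 - y2 - y3)) ∈ S ∧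
        ‖L (vec3 (v0.1 - z.1 - z.2, v0.2 - y2 - y3))‖ ≤ R1)} ∩
      (fun z : ℝ × ℝ => P (L (vec3 (v0.1 - z.1 - z.2, v0.2 - y2 - y3))) +
        P (L (vec3 (z.1, y2))) + P (L (vec3 (z.2, y3)))) ⁻¹' Set.Icc a (a + δ))
    ≤ ENNReal.ofReal (2 * Real.pi * δ * (R2 / c) * (R3 / c)) := by
  set D := {z : ℝ × ℝ | ((L (vec3 (z.1, y2)) ∈ S ∧ ‖L (vec3 (z.1, y2))‖ ≤ R2) ∧
      (L (vec3 (z.2, y3)) ∈ S ∧ ‖L (vec3 (z.2, y3))‖ ≤ R3)) ∧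
      (L (vec3 (v0.1 - z.1 - z.2, v0.2 - y2 - y3)) ∈ S ∧
        ‖L (vec3 (v0.1 - z.1 - z.2, v0.2 - y2 - y3))‖ ≤ R1)} with hD
  have c1 : Continuous (fun z : ℝ × ℝ => L (vec3 (z.1, y2))) :=
    L.continuous.comp (vec3_cont.comp (by fun_prop))
  have c2 : Continuous (fun z : ℝ × ℝ => L (vec3 (z.2, y3))) :=
    L.continuous.comp (vec3_cont.comp (by fun_prop))
  have c3 : Continuous (fun z : ℝ × ℝ => L (vec3 (v0.1 - z.1 - z.2, v0.2 - y2 - y3))) :=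
    L.continuous.comp (vec3_cont.comp (by fun_prop))
  have bd : ∀ s : ℝ, ∀ y, |s| ≤ ‖L (vec3 (s, y))‖ := by
    intro s y
    rw [L.norm_map, norm_vec3, ← Real.sqrt_sq_eq_abs]
    apply Real.sqrt_le_sqrt
    simp only
    nlinarith [sq_nonneg y.1, sq_nonneg y.2]
  have cvx : ∀ (R : ℝ) (θ : ℝ), 0 ≤ θ → θ ≤ 1 → ∀ y s s', ‖L (vec3 (s, y))‖ ≤ R →
      ‖L (vec3 (s', y))‖ ≤ R → ‖L (vec3 ((1 - θ) * s + θ * s', y))‖ ≤ R := by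
    intro R θ h0 h1 y s s' hs hs'
    have e : vec3 ((1 - θ) * s + θ * s', y) = (1 - θ) • vec3 (s, y) + θ • vec3 (s', y) := by
      ext i; fin_cases i <;> simp [vec3] <;> ring
    rw [e, map_add, map_smul, map_smul]
    have := (convex_closedBall (0 : E3) R) (x := L (vec3 (s, y))) (by simpa using hs)
      (y := L (vec3 (s', y))) (by simpa using hs') (sub_nonneg.2 h1) h0 (by ring)
    simpa using this
  apply vol_strip_scaled _ _ (by positivity) (by positivity) _ a δ hδ
  · apply Metric.isCompact_of_isClosed_isBounded
    · exact (((hG.closed.preimage c1).inter (isClosed_le c1.norm continuous_const)).inter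
        ((hG.closed.preimage c2).inter (isClosed_le c2.norm continuous_const))).inter
        ((hG.closed.preimage c3).inter (isClosed_le c3.norm continuous_const))
    · apply (Metric.isBounded_Icc (-R2, -R3) (R2, R3)).subset
      intro z hz
      have h2 := abs_le.1 ((bd z.1 y2).trans hz.1.1.2)
      have h3 := abs_le.1 ((bd z.2 y3).trans hz.1.2.2)
      exact ⟨⟨h2.1, h3.1⟩, ⟨h2.2, h3.2⟩⟩
  · apply ContinuousOn.add
    · apply ContinuousOn.add
      · exact (hG.cont (v0.2 - y2 - y3)).comp (f := fun z : ℝ × ℝ => v0.1 - z.1 - z.2)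
          (by fun_prop) (fun z hz => hz.2.1)
      · exact (hG.cont y2).comp (f := fun z : ℝ × ℝ => z.1) (by fun_prop) (fun z hz => hz.1.1.1)
    · exact (hG.cont y3).comp (f := fun z : ℝ × ℝ => z.2) (by fun_prop) (fun z hz => hz.1.2.1)
  · intro z hz w hw θ h0 h1
    have A1 := hG.sc R1 hR1 _ _ _ hz.2.1 hw.2.1 hz.2.2 hw.2.2 θ h0 h1
    have A2 := hG.sc R2 hR2 _ _ _ hz.1.1.1 hw.1.1.1 hz.1.1.2 hw.1.1.2 θ h0 h1
    have A3 := hG.sc R3 hR3 _ _ _ hz.1.2.1 hw.1.2.1 hz.1.2.2 hw.1.2.2 θ h0 h1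
    have B1 := cvx R1 θ h0 h1 _ _ _ hz.2.2 hw.2.2
    have B2 := cvx R2 θ h0 h1 _ _ _ hz.1.1.2 hw.1.1.2
    have B3 := cvx R3 θ h0 h1 _ _ _ hz.1.2.2 hw.1.2.2
    have e1 : (1 - θ) * (v0.1 - z.1 - z.2) + θ * (v0.1 - w.1 - w.2) =
        v0.1 - ((1 - θ) * z.1 + θ * w.1) - ((1 - θ) * z.2 + θ * w.2) := by ring
    rw [e1] at A1 B1
    refine ⟨⟨⟨⟨A2.1, B2⟩, ⟨A3.1, B3⟩⟩, ⟨A1.1, B1⟩⟩, ?_⟩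
    simp only [Prod.fst_add, Prod.snd_add, Prod.smul_fst, Prod.smul_snd, smul_eq_mul]
    have hn : 0 ≤ θ * (1 - θ) * (((v0.1 - w.1 - w.2) - (v0.1 - z.1 - z.2)) / (R1 / c)) ^ 2 / 2 := by
      have : 0 ≤ 1 - θ := sub_nonneg.2 h1
      positivity
    linarith [A1.2, A2.2, A3.2]

lemma slice6 {P : E3 → ℝ} (hP : Measurable P) {S : Set E3} {L : E3 ≃ₗᵢ[ℝ] E3} {c : ℝ} (hc : 0 < c)
    (hG : GoodCone P S L c) {R1 R2 R3 : ℝ} (hR1 : 0 < R1) (hR2 : 0 < R2) (hR3 : 0 < R3)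
    (ζ : E3) (a δ : ℝ) (hδ : 0 ≤ δ) :
    volume ({w : E3 × E3 | ((w.1 ∈ S ∧ ‖w.1‖ ≤ R2) ∧ (w.2 ∈ S ∧ ‖w.2‖ ≤ R3)) ∧
      (ζ - w.1 - w.2 ∈ S ∧ ‖ζ - w.1 - w.2‖ ≤ R1)} ∩
      (fun w : E3 × E3 => P (ζ - w.1 - w.2) + P w.1 + P w.2) ⁻¹' Set.Icc a (a + δ))
    ≤ ENNReal.ofReal (32 * Real.pi / c ^ 2 * R2 ^ 3 * R3 ^ 3 * δ) := by
  set Ω := ({w : E3 × E3 | ((w.1 ∈ S ∧ ‖w.1‖ ≤ R2) ∧ (w.2 ∈ S ∧ ‖w.2‖ ≤ R3)) ∧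
      (ζ - w.1 - w.2 ∈ S ∧ ‖ζ - w.1 - w.2‖ ≤ R1)} ∩
      (fun w : E3 × E3 => P (ζ - w.1 - w.2) + P w.1 + P w.2) ⁻¹' Set.Icc a (a + δ)) with hΩ
  have hΩm : MeasurableSet Ω := by
    apply MeasurableSet.inter
    · have c1 : Continuous (fun z : E3 × E3 => z.1) := by fun_prop
      have c2 : Continuous (fun z : E3 × E3 => z.2) := by fun_prop
      have c3 : Continuous (fun z : E3 × E3 => ζ - z.1 - z.2) := by fun_prop
      exact ((((hG.closed.preimage c1).inter (isClosed_le c1.norm continuous_const)).inter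
        ((hG.closed.preimage c2).inter (isClosed_le c2.norm continuous_const))).inter
        ((hG.closed.preimage c3).inter (isClosed_le c3.norm continuous_const))).measurableSet
    · have hm : Measurable (fun w : E3 × E3 => P (ζ - w.1 - w.2) + P w.1 + P w.2) := by fun_prop
      exact hm measurableSet_Icc
  obtain ⟨v0, hv0⟩ := vec3_surj (L.symm ζ)
  have hLv : MeasurePreserving (fun v => L (vec3 v)) := L.measurePreserving.comp vec3_mp
  have hM : MeasurePreserving (fun u : ((ℝ × ℝ) × (ℝ × ℝ)) × (ℝ × ℝ) =>
      ((L (vec3 (u.2.1, u.1.1)), L (vec3 (u.2.2, u.1.2))) : E3 × E3)) := by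
    have h1 := mp_rearrange (A := ℝ) (B := ℝ) (C := ℝ × ℝ) (D := ℝ × ℝ)
    have h2 := hLv.prod hLv
    have h3 := Measure.measurePreserving_swap (μ := (volume : Measure ((ℝ × ℝ) × (ℝ × ℝ))))
      (ν := (volume : Measure (ℝ × ℝ)))
    exact h2.comp (h1.comp h3)
  rw [← hM.measure_preimage hΩm.nullMeasurableSet, Measure.volume_eq_prod,
    Measure.prod_apply (hM.measurable hΩm)]
  set Y : Set ((ℝ × ℝ) × (ℝ × ℝ)) := (Set.Icc (-R2) R2 ×ˢ Set.Icc (-R2) R2) ×ˢ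
    (Set.Icc (-R3) R3 ×ˢ Set.Icc (-R3) R3) with hY
  have hYm : MeasurableSet Y := (measurableSet_Icc.prod measurableSet_Icc).prod
    (measurableSet_Icc.prod measurableSet_Icc)
  have bd : ∀ s : ℝ, ∀ y : ℝ × ℝ, |y.1| ≤ ‖L (vec3 (s, y))‖ ∧ |y.2| ≤ ‖L (vec3 (s, y))‖ := by
    intro s y
    rw [L.norm_map, norm_vec3, ← Real.sqrt_sq_eq_abs, ← Real.sqrt_sq_eq_abs]
    constructor <;>
    · apply Real.sqrt_le_sqrt
      simp only
      nlinarith [sq_nonneg y.1, sq_nonneg y.2, sq_nonneg s]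
  calc _ ≤ ∫⁻ y : (ℝ × ℝ) × (ℝ × ℝ), Y.indicator
        (fun _ => ENNReal.ofReal (2 * Real.pi * δ * (R2 / c) * (R3 / c))) y := by
        apply lintegral_mono
        intro y
        by_cases hy : y ∈ Y
        · rw [Set.indicator_of_mem hy]
          refine le_trans (measure_mono ?_) (slice2 hc hG hR1 hR2 hR3 v0 y.1 y.2 a δ hδ)
          intro z hz
          have e : L (vec3 (v0.1 - z.1 - z.2, v0.2 - y.1 - y.2)) =
              ζ - L (vec3 (z.1, y.1)) - L (vec3 (z.2, y.2)) := by
            have : (v0.1 - z.1 - z.2, v0.2 - y.1 - y.2) = v0 - (z.1, y.1) - (z.2, y.2) := rfl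
            rw [this, vec3_sub, vec3_sub, hv0, map_sub, map_sub, L.apply_symm_apply]
          have hz' : (L (vec3 (z.1, y.1)), L (vec3 (z.2, y.2))) ∈ Ω := hz
          rw [hΩ] at hz'
          rw [Set.mem_inter_iff, Set.mem_preimage, Set.mem_setOf_eq, e]
          exact hz'
        · rw [Set.indicator_of_notMem hy]
          beta_reduce
          rw [nonpos_iff_eq_zero]
          convert measure_empty (μ := (volume : Measure (ℝ × ℝ)))
          rw [Set.eq_empty_iff_forall_notMem]
          intro z hz
          apply hy
          have h2 : ‖L (vec3 (z.1, y.1))‖ ≤ R2 := hz.1.1.1.2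
          have h3 : ‖L (vec3 (z.2, y.2))‖ ≤ R3 := hz.1.1.2.2
          have b2 := bd z.1 y.1
          have b3 := bd z.2 y.2
          exact ⟨⟨abs_le.1 (b2.1.trans h2), abs_le.1 (b2.2.trans h2)⟩,
            ⟨abs_le.1 (b3.1.trans h3), abs_le.1 (b3.2.trans h3)⟩⟩
    _ = _ := by
        rw [lintegral_indicator_const hYm, hY, Measure.volume_eq_prod, Measure.prod_prod,
          Measure.volume_eq_prod, Measure.prod_prod, Measure.prod_prod, Real.volume_Icc,
          Real.volume_Icc, ← ENNReal.ofReal_mul (by linarith), ← ENNReal.ofReal_mul (by linarith),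
          ← ENNReal.ofReal_mul (by nlinarith), ← ENNReal.ofReal_mul (by positivity)]
        congr 1
        field_simp
        ring



lemma map_le_of_strip {X : Type*} [MeasurableSpace X] (μ : Measure X) {F : X → ℝ}
    (hF : Measurable F) {M : ℝ} (hM : 0 < M)
    (h : ∀ a δ : ℝ, 0 ≤ δ → μ (F ⁻¹' Set.Icc a (a + δ)) ≤ ENNReal.ofReal (M * δ)) :
    μ.map F ≤ ENNReal.ofReal M • volume := by
  have hM0 : ENNReal.ofReal M ≠ 0 := by simpa using hM
  have hMt : ENNReal.ofReal M ≠ ⊤ := ENNReal.ofReal_ne_top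
  have key : (ENNReal.ofReal M)⁻¹ • μ.map F ≤ volume := by
    rw [← hausdorffMeasure_real]
    apply Measure.le_hausdorffMeasure 1 _ 1 one_pos
    intro s hs
    have hb : Bornology.IsBounded s := by
      rw [Metric.isBounded_iff_ediam_ne_top]
      exact ne_top_of_le_ne_top ENNReal.one_ne_top hs
    rcases s.eq_empty_or_nonempty with rfl | hne
    · simp
    rw [Real.ediam_eq hb, ENNReal.rpow_one, Measure.smul_apply, smul_eq_mul]
    have hle : sInf s ≤ sSup s := Real.sInf_le_sSup s hb.bddBelow hb.bddAbove
    have hsub : s ⊆ Set.Icc (sInf s) (sInf s + (sSup s - sInf s)) := by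
      intro x hx
      refine ⟨csInf_le hb.bddBelow hx, ?_⟩
      have := le_csSup hb.bddAbove hx
      linarith
    calc _ ≤ (ENNReal.ofReal M)⁻¹ * μ.map F (Set.Icc (sInf s) (sInf s + (sSup s - sInf s))) := by
          gcongr
      _ ≤ (ENNReal.ofReal M)⁻¹ * ENNReal.ofReal (M * (sSup s - sInf s)) := by
          rw [Measure.map_apply hF measurableSet_Icc]
          gcongr
          exact h _ _ (sub_nonneg.2 hle)
      _ = _ := by
          rw [ENNReal.ofReal_mul hM.le, ← mul_assoc, ENNReal.inv_mul_cancel hM0 hMt, one_mul]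
  calc μ.map F = ENNReal.ofReal M • ((ENNReal.ofReal M)⁻¹ • μ.map F) := by
        rw [smul_smul, ENNReal.mul_inv_cancel hM0 hMt, one_smul]
    _ ≤ _ := by gcongr

lemma gauss_lintegral {ε : ℝ} (hε : 0 < ε) (τ : ℝ) :
    ∫⁻ u : ℝ, ‖((Real.pi / ε : ℂ) ^ (1 / 2 : ℂ) * cexp (-((τ - u : ℝ) : ℂ) ^ 2 / (4 * ε)))‖ₑ
      = ENNReal.ofReal (2 * Real.pi) := by
  have e1 : ∀ u : ℝ, ‖((Real.pi / ε : ℂ) ^ (1 / 2 : ℂ) *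
      cexp (-((τ - u : ℝ) : ℂ) ^ 2 / (4 * ε)))‖ₑ =
      ENNReal.ofReal (Real.sqrt (Real.pi / ε) * Real.exp (-(1 / (4 * ε)) * (u - τ) ^ 2)) := by
    intro u
    rw [← ofReal_norm, norm_mul]
    congr 2
    · rw [Real.sqrt_eq_rpow]
      have : (Real.pi / ε : ℂ) ^ (1 / 2 : ℂ) = (((Real.pi / ε) ^ (1 / 2 : ℝ) : ℝ) : ℂ) := by
        rw [Complex.ofReal_cpow (by positivity)]; push_cast; rfl
      rw [this, Complex.norm_real, Real.norm_of_nonneg (by positivity)]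
    · have : (-((τ - u : ℝ) : ℂ) ^ 2 / (4 * ε)) = ((-(1 / (4 * ε)) * (u - τ) ^ 2 : ℝ) : ℂ) := by
        push_cast; field_simp; ring
      rw [this, ← Complex.ofReal_exp, Complex.norm_real, Real.norm_of_nonneg (Real.exp_pos _).le]
  simp_rw [e1]
  rw [lintegral_sub_right_eq_self (fun u => ENNReal.ofReal (Real.sqrt (Real.pi / ε) *
    Real.exp (-(1 / (4 * ε)) * u ^ 2))) τ]
  rw [← ofReal_integral_eq_lintegral_ofReal]
  · rw [integral_const_mul, integral_gaussian, ← Real.sqrt_mul (by positivity)]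
    congr 1
    rw [show Real.pi / ε * (Real.pi / (1 / (4 * ε))) = (2 * Real.pi) ^ 2 by field_simp; ring]
    exact Real.sqrt_sq (by positivity)
  · exact (integrable_exp_neg_mul_sq (by positivity)).const_mul _
  · exact Filter.Eventually.of_forall fun u => by positivity

lemma two_mul_le_sq_ennreal (x y : ℝ≥0∞) : 2 * (x * y) ≤ x ^ 2 + y ^ 2 := by
  rcases eq_or_ne x ⊤ with rfl | hx
  · simp
  rcases eq_or_ne y ⊤ with rfl | hy
  · simp
  lift x to NNReal using hx
  lift y to NNReal using hy
  have : 2 * (x * y) ≤ x ^ 2 + y ^ 2 := by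
    rw [← mul_assoc]; exact two_mul_le_add_sq x y
  exact_mod_cast this

lemma schur_gen {X : Type*} [MeasurableSpace X] (μ : Measure X) [SFinite μ]
    {b : X → ℂ} (hb : Integrable b μ) {k : X × X → ℝ≥0∞} (hk : Measurable k)
    (hke : ∀ x y, k (x, y) = k (y, x)) {K : ℝ≥0∞}
    (hin : ∀ x, ∫⁻ y, k (x, y) ∂μ ≤ K) :
    ∫⁻ p : X × X, ‖b p.1‖ₑ * ‖b p.2‖ₑ * k p ∂(μ.prod μ) ≤ K * ∫⁻ x, ‖b x‖ₑ ^ 2 ∂μ := by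
  have hbm : AEMeasurable (fun x => ‖b x‖ₑ) μ := hb.1.enorm
  have hm1 : AEMeasurable (fun p : X × X => ‖b p.1‖ₑ) (μ.prod μ) :=
    hbm.comp_quasiMeasurePreserving Measure.quasiMeasurePreserving_fst
  have hm2 : AEMeasurable (fun p : X × X => ‖b p.2‖ₑ) (μ.prod μ) :=
    hbm.comp_quasiMeasurePreserving Measure.quasiMeasurePreserving_snd
  have hmA : AEMeasurable (fun p : X × X => ‖b p.1‖ₑ ^ 2 * k p) (μ.prod μ) :=
    (hm1.pow_const 2).mul hk.aemeasurable
  have hmB : AEMeasurable (fun p : X × X => ‖b p.1‖ₑ * ‖b p.2‖ₑ * k p) (μ.prod μ) :=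
    (hm1.mul hm2).mul hk.aemeasurable
  have hA : ∫⁻ p : X × X, ‖b p.1‖ₑ ^ 2 * k p ∂(μ.prod μ) ≤ K * ∫⁻ x, ‖b x‖ₑ ^ 2 ∂μ := by
    rw [lintegral_prod _ hmA, ← lintegral_const_mul'' _ (hbm.pow_const 2)]
    apply lintegral_mono
    intro x
    simp only
    rw [lintegral_const_mul _ (by fun_prop), mul_comm]
    gcongr
    exact hin x
  have hB : ∫⁻ p : X × X, ‖b p.2‖ₑ ^ 2 * k p ∂(μ.prod μ) ≤ K * ∫⁻ x, ‖b x‖ₑ ^ 2 ∂μ := by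
    rw [← lintegral_prod_swap]
    refine le_trans (le_of_eq (lintegral_congr fun p => ?_)) hA
    simp only [Prod.snd_swap]
    rw [show k p.swap = k p from hke _ _]
  have h2 : ∀ x y z : ℝ≥0∞, 2 * (x * y * z) ≤ x ^ 2 * z + y ^ 2 * z := by
    intro x y z
    rw [← add_mul, ← mul_assoc]
    gcongr
    exact two_mul_le_sq_ennreal x y
  have hfin : 2 * ∫⁻ p : X × X, ‖b p.1‖ₑ * ‖b p.2‖ₑ * k p ∂(μ.prod μ) ≤
      2 * (K * ∫⁻ x, ‖b x‖ₑ ^ 2 ∂μ) := by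
    rw [← lintegral_const_mul'' _ hmB]
    calc _ ≤ ∫⁻ p : X × X, (‖b p.1‖ₑ ^ 2 * k p +
            ‖b p.2‖ₑ ^ 2 * k p) ∂(μ.prod μ) := lintegral_mono fun p => h2 _ _ _
      _ = _ := lintegral_add_left' hmA _
      _ ≤ _ := by rw [two_mul]; gcongr
  exact (ENNReal.mul_le_mul_iff_right (by simp) (by simp)).1 hfin

lemma schur_bound {X : Type*} [MeasurableSpace X] (μ : Measure X) [SFinite μ] {F : X → ℝ}
    (hF : Measurable F) {M : ℝ} (hM : 0 < M)
    (h : ∀ a δ : ℝ, 0 ≤ δ → μ (F ⁻¹' Set.Icc a (a + δ)) ≤ ENNReal.ofReal (M * δ))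
    {b : X → ℂ} (hb : Integrable b μ) {k : ℝ → ℝ≥0∞} (hk : Measurable k) (hke : ∀ u, k (-u) = k u)
    (hkI : ∀ τ, ∫⁻ u, k (τ - u) = ENNReal.ofReal (2 * Real.pi)) :
    ∫⁻ p : X × X, ‖b p.1‖ₑ * ‖b p.2‖ₑ * k (F p.1 - F p.2) ∂(μ.prod μ) ≤
      ENNReal.ofReal (2 * Real.pi * M) * ∫⁻ x, ‖b x‖ₑ ^ 2 ∂μ := by
  refine schur_gen μ hb (k := fun p => k (F p.1 - F p.2)) (by fun_prop) ?_ ?_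
  · intro x y
    simp only
    rw [← hke, neg_sub]
  · intro x
    calc ∫⁻ y, k (F x - F y) ∂μ = ∫⁻ u, k (F x - u) ∂(μ.map F) := by
          rw [lintegral_map (by fun_prop) hF]
      _ ≤ ∫⁻ u, k (F x - u) ∂(ENNReal.ofReal M • volume) :=
          lintegral_mono' (map_le_of_strip μ hF hM h) le_rfl
      _ = _ := by
          rw [lintegral_smul_measure, hkI, smul_eq_mul, ← ENNReal.ofReal_mul hM.le, mul_comm]

lemma time_reg {X : Type*} [MeasurableSpace X] (μ : Measure X) [SFinite μ] {F : X → ℝ}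
    (hF : Measurable F) {M : ℝ} (hM : 0 < M)
    (h : ∀ a δ : ℝ, 0 ≤ δ → μ (F ⁻¹' Set.Icc a (a + δ)) ≤ ENNReal.ofReal (M * δ))
    {b : X → ℂ} (hb : Integrable b μ) {ε : ℝ} (hε : 0 < ε) :
    ∫⁻ t : ℝ, ENNReal.ofReal (Real.exp (-ε * t ^ 2)) *
      ‖∫ x, cexp (I * ((t * F x : ℝ) : ℂ)) * b x ∂μ‖ₑ ^ 2 ≤
      ENNReal.ofReal (2 * Real.pi * M) * ∫⁻ x, ‖b x‖ₑ ^ 2 ∂μ := by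
  set g : ℝ → ℂ := fun t => ∫ x, cexp (I * ((t * F x : ℝ) : ℂ)) * b x ∂μ with hg
  set H : ℝ × (X × X) → ℂ := fun q => cexp (-ε * (q.1 : ℂ) ^ 2) *
    (cexp (I * ((q.1 * (F q.2.1 - F q.2.2) : ℝ) : ℂ)) *
      (b q.2.1 * (starRingEnd ℂ) (b q.2.2))) with hH
  have hbc : Integrable (fun x => (starRingEnd ℂ) (b x)) μ :=
    (LinearIsometryEquiv.integrable_comp_iff Complex.conjLIE).2 hb
  have hgauss : Integrable (fun t : ℝ => cexp (-ε * (t : ℂ) ^ 2)) :=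
    integrable_cexp_neg_mul_sq (b := (ε : ℂ)) (by simpa using hε)
  have hHint : Integrable H (volume.prod (μ.prod μ)) := by
    have h0 := hgauss.mul_prod (hb.mul_prod hbc)
    have : H = fun q => cexp (I * ((q.1 * (F q.2.1 - F q.2.2) : ℝ) : ℂ)) *
        (cexp (-ε * (q.1 : ℂ) ^ 2) * (b q.2.1 * (starRingEnd ℂ) (b q.2.2))) := by
      funext q; simp only [hH]; ring
    rw [this]
    apply h0.bdd_mul (c := 1)
    · apply Measurable.aestronglyMeasurable; fun_prop
    · apply Filter.Eventually.of_forall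
      intro q
      rw [mul_comm I, Complex.norm_exp_ofReal_mul_I]
  have hmod : ∀ t, ∫ p, H (t, p) ∂(μ.prod μ) =
      ((Real.exp (-ε * t ^ 2) * ‖g t‖ ^ 2 : ℝ) : ℂ) := by
    intro t
    simp only [hH]
    rw [integral_const_mul]
    have e1 : ∀ p : X × X, cexp (I * ((t * (F p.1 - F p.2) : ℝ) : ℂ)) *
        (b p.1 * (starRingEnd ℂ) (b p.2)) = (cexp (I * ((t * F p.1 : ℝ) : ℂ)) * b p.1) *
        (starRingEnd ℂ) (cexp (I * ((t * F p.2 : ℝ) : ℂ)) * b p.2) := by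
      intro p
      rw [map_mul, ← Complex.exp_conj, map_mul, Complex.conj_I, Complex.conj_ofReal]
      have : I * ((t * (F p.1 - F p.2) : ℝ) : ℂ) = I * ((t * F p.1 : ℝ) : ℂ) +
        -I * ((t * F p.2 : ℝ) : ℂ) := by push_cast; ring
      rw [this, Complex.exp_add]; ring
    simp_rw [e1]
    rw [integral_prod_mul (fun x => cexp (I * ((t * F x : ℝ) : ℂ)) * b x)
      (fun x => (starRingEnd ℂ) (cexp (I * ((t * F x : ℝ) : ℂ)) * b x)), integral_conj,
      Complex.mul_conj, Complex.normSq_eq_norm_sq]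
    rw [Complex.ofReal_mul, Complex.ofReal_exp]
    congr 2
    push_cast
    ring
  have hR : Integrable (fun t => Real.exp (-ε * t ^ 2) * ‖g t‖ ^ 2) := by
    have := hHint.integral_prod_left
    simp_rw [hmod] at this
    exact (this.re).congr (Filter.Eventually.of_forall fun t => Complex.ofReal_re _)
  have hL : ∫⁻ t : ℝ, ENNReal.ofReal (Real.exp (-ε * t ^ 2)) * ‖g t‖ₑ ^ 2 =
      ‖∫ q, H q ∂(volume.prod (μ.prod μ))‖ₑ := by
    rw [integral_prod _ hHint]
    simp_rw [hmod]
    rw [integral_complex_ofReal, ← ofReal_norm, Complex.norm_real, Real.norm_of_nonneg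
      (integral_nonneg fun t => by positivity), ofReal_integral_eq_lintegral_ofReal hR
      (Filter.Eventually.of_forall fun t => by positivity)]
    refine lintegral_congr fun t => ?_
    rw [ENNReal.ofReal_mul (Real.exp_pos _).le, ENNReal.ofReal_pow (norm_nonneg _),
      ofReal_norm]
  rw [hL, integral_prod_symm _ hHint]
  refine (enorm_integral_le_lintegral_enorm _).trans ?_
  set K : ℝ → ℂ := fun τ => (Real.pi / ε : ℂ) ^ (1 / 2 : ℂ) * cexp (-((τ : ℝ) : ℂ) ^ 2 / (4 * ε))
    with hK
  have hin : ∀ p : X × X, ‖∫ t, H (t, p)‖ₑ = ‖b p.1‖ₑ * ‖b p.2‖ₑ * ‖K (F p.1 - F p.2)‖ₑ := by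
    intro p
    have e2 : ∀ t : ℝ, H (t, p) = (cexp (I * ((F p.1 - F p.2 : ℝ) : ℂ) * t) *
        cexp (-ε * (t : ℂ) ^ 2)) * (b p.1 * (starRingEnd ℂ) (b p.2)) := by
      intro t
      simp only [hH]
      rw [mul_left_comm, mul_assoc]
      congr 2
      push_cast; ring
    simp_rw [e2]
    rw [integral_mul_const, fourierIntegral_gaussian (by simpa using hε), enorm_mul, mul_comm]
    congr 1
    rw [enorm_mul]
    congr 1
    rw [← ofReal_norm, RCLike.norm_conj, ofReal_norm]
  simp_rw [hin]
  apply schur_bound μ hF hM h hb (k := fun τ => ‖K τ‖ₑ)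
  · simp only [hK]; fun_prop
  · intro u; simp only [hK]; push_cast; rw [neg_sq]
  · intro τ
    exact gauss_lintegral hε τ

lemma time_planch {X : Type*} [MeasurableSpace X] (μ : Measure X) [SFinite μ] {F : X → ℝ}
    (hF : Measurable F) {M : ℝ} (hM : 0 < M)
    (h : ∀ a δ : ℝ, 0 ≤ δ → μ (F ⁻¹' Set.Icc a (a + δ)) ≤ ENNReal.ofReal (M * δ))
    {b : X → ℂ} (hb : Integrable b μ) :
    ∫⁻ t : ℝ, ‖∫ x, cexp (I * ((t * F x : ℝ) : ℂ)) * b x ∂μ‖ₑ ^ 2 ≤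
      ENNReal.ofReal (2 * Real.pi * M) * ∫⁻ x, ‖b x‖ₑ ^ 2 ∂μ := by
  set g : ℝ → ℂ := fun t => ∫ x, cexp (I * ((t * F x : ℝ) : ℂ)) * b x ∂μ with hg
  have hgm : AEMeasurable (fun t => ‖g t‖ₑ ^ 2) := by
    refine AEMeasurable.pow_const ?_ 2
    refine AEStronglyMeasurable.enorm ?_
    have : AEStronglyMeasurable (fun q : ℝ × X => cexp (I * ((q.1 * F q.2 : ℝ) : ℂ)) * b q.2)
        (volume.prod μ) := by
      apply AEStronglyMeasurable.mul
      · apply Measurable.aestronglyMeasurable; fun_prop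
      · exact hb.1.comp_snd
    exact this.integral_prod_right'
  have hlim := lintegral_tendsto_of_tendsto_of_monotone (μ := volume)
    (f := fun (n : ℕ) (t : ℝ) => ENNReal.ofReal (Real.exp (-(1 / ((n : ℝ) + 1)) * t ^ 2)) *
      ‖g t‖ₑ ^ 2) (F := fun t => ‖g t‖ₑ ^ 2) ?_ ?_ ?_
  · exact le_of_tendsto' hlim fun n => time_reg μ hF hM h hb (by positivity)
  · intro n
    apply AEMeasurable.mul _ hgm
    apply Measurable.aemeasurable; fun_prop
  · apply Filter.Eventually.of_forall
    intro t n m hnm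
    simp only
    have : (1 / ((m : ℝ) + 1)) ≤ 1 / ((n : ℝ) + 1) := by gcongr
    gcongr
  · apply Filter.Eventually.of_forall
    intro t
    have h1 : Filter.Tendsto (fun n : ℕ => ENNReal.ofReal (Real.exp (-(1 / ((n : ℝ) + 1)) * t ^ 2)))
        Filter.atTop (nhds 1) := by
      rw [← ENNReal.ofReal_one, ← Real.exp_zero]
      apply ENNReal.tendsto_ofReal
      apply (Real.continuous_exp.tendsto _).comp
      have := (tendsto_one_div_add_atTop_nhds_zero_nat (𝕜 := ℝ)).neg.mul_const (t ^ 2)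
      simpa using this
    have := ENNReal.Tendsto.mul_const (b := ‖g t‖ₑ ^ 2) h1 (Or.inl one_ne_zero)
    simpa using this



lemma gauss_lintegral3 {ε : ℝ} (hε : 0 < ε) (τ : E3) :
    ∫⁻ u : E3, ‖((Real.pi / ε : ℂ) ^ (3 / 2 : ℂ) * cexp (I ^ 2 * (‖τ - u‖ : ℂ) ^ 2 / (4 * ε)))‖ₑ
      = ENNReal.ofReal ((2 * Real.pi) ^ 3) := by
  have e1 : ∀ u : E3, ‖((Real.pi / ε : ℂ) ^ (3 / 2 : ℂ) *
      cexp (I ^ 2 * (‖τ - u‖ : ℂ) ^ 2 / (4 * ε)))‖ₑ =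
      ENNReal.ofReal ((Real.pi / ε) ^ (3 / 2 : ℝ) * Real.exp (-(1 / (4 * ε)) * ‖u - τ‖ ^ 2)) := by
    intro u
    rw [← ofReal_norm, norm_mul]
    congr 2
    · have : (Real.pi / ε : ℂ) ^ (3 / 2 : ℂ) = (((Real.pi / ε) ^ (3 / 2 : ℝ) : ℝ) : ℂ) := by
        rw [Complex.ofReal_cpow (by positivity)]; push_cast; rfl
      rw [this, Complex.norm_real, Real.norm_of_nonneg (by positivity)]
    · have : I ^ 2 * (‖τ - u‖ : ℂ) ^ 2 / (4 * ε) = ((-(1 / (4 * ε)) * ‖u - τ‖ ^ 2 : ℝ) : ℂ) := by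
        rw [I_sq, norm_sub_rev]
        push_cast; field_simp
      rw [this, ← Complex.ofReal_exp, Complex.norm_real, Real.norm_of_nonneg (Real.exp_pos _).le]
  simp_rw [e1]
  rw [lintegral_sub_right_eq_self (fun u : E3 => ENNReal.ofReal ((Real.pi / ε) ^ (3 / 2 : ℝ) *
    Real.exp (-(1 / (4 * ε)) * ‖u‖ ^ 2))) τ]
  have hi : Integrable (fun u : E3 => Real.exp (-(1 / (4 * ε)) * ‖u‖ ^ 2)) := by
    have := (GaussianFourier.integrable_cexp_neg_mul_sq_norm_add (V := E3)
      (b := ((1 / (4 * ε) : ℝ) : ℂ)) (by rw [Complex.ofReal_re]; positivity) 0 0).re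
    refine this.congr (Filter.Eventually.of_forall fun u => ?_)
    simp only [zero_mul, add_zero]
    rw [show (-((1 / (4 * ε) : ℝ) : ℂ) * (‖u‖ : ℂ) ^ 2) = ((-(1 / (4 * ε)) * ‖u‖ ^ 2 : ℝ) : ℂ) by
      push_cast; ring, ← Complex.ofReal_exp]
    exact Complex.ofReal_re _
  rw [← ofReal_integral_eq_lintegral_ofReal]
  · rw [integral_const_mul, GaussianFourier.integral_rexp_neg_mul_sq_norm (by positivity),
      finrank_euclideanSpace_fin]
    congr 1
    push_cast
    rw [← Real.mul_rpow (by positivity) (by positivity),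
      show Real.pi / ε * (Real.pi / (1 / (4 * ε))) = (2 * Real.pi) ^ 2 by field_simp; ring,
      ← Real.rpow_natCast (2 * Real.pi) 2, ← Real.rpow_mul (by positivity)]
    rw [← Real.rpow_natCast]
    norm_num
  · exact hi.const_mul _
  · exact Filter.Eventually.of_forall fun u => by positivity

lemma space_reg {b : E3 → ℂ} (hb : Integrable b) {ε : ℝ} (hε : 0 < ε) :
    ∫⁻ t : E3, ENNReal.ofReal (Real.exp (-ε * ‖t‖ ^ 2)) *
      ‖∫ x, cexp (I * ((⟪t, x⟫ : ℝ) : ℂ)) * b x‖ₑ ^ 2 ≤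
      ENNReal.ofReal ((2 * Real.pi) ^ 3) * ∫⁻ x, ‖b x‖ₑ ^ 2 := by
  set g : E3 → ℂ := fun t => ∫ x, cexp (I * ((⟪t, x⟫ : ℝ) : ℂ)) * b x with hg
  set H : E3 × (E3 × E3) → ℂ := fun q => cexp (-ε * (‖q.1‖ : ℂ) ^ 2) *
    (cexp (I * ((⟪q.1, q.2.1 - q.2.2⟫ : ℝ) : ℂ)) *
      (b q.2.1 * (starRingEnd ℂ) (b q.2.2))) with hH
  have hbc : Integrable (fun x => (starRingEnd ℂ) (b x)) :=
    (LinearIsometryEquiv.integrable_comp_iff Complex.conjLIE).2 hb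
  have hgauss : Integrable (fun t : E3 => cexp (-ε * (‖t‖ : ℂ) ^ 2)) := by
    have := GaussianFourier.integrable_cexp_neg_mul_sq_norm_add (V := E3)
      (b := (ε : ℂ)) (by simpa using hε) 0 0
    simpa using this
  have hHint : Integrable H (volume.prod (volume.prod volume)) := by
    have h0 := hgauss.mul_prod (hb.mul_prod hbc)
    have : H = fun q => cexp (I * ((⟪q.1, q.2.1 - q.2.2⟫ : ℝ) : ℂ)) *
        (cexp (-ε * (‖q.1‖ : ℂ) ^ 2) * (b q.2.1 * (starRingEnd ℂ) (b q.2.2))) := by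
      funext q; simp only [hH]; ring
    rw [this]
    apply h0.bdd_mul (c := 1)
    · apply Continuous.aestronglyMeasurable; fun_prop
    · apply Filter.Eventually.of_forall
      intro q
      rw [mul_comm I, Complex.norm_exp_ofReal_mul_I]
  have hmod : ∀ t, ∫ p, H (t, p) ∂(volume.prod volume) =
      ((Real.exp (-ε * ‖t‖ ^ 2) * ‖g t‖ ^ 2 : ℝ) : ℂ) := by
    intro t
    simp only [hH]
    rw [integral_const_mul]
    have e1 : ∀ p : E3 × E3, cexp (I * ((⟪t, p.1 - p.2⟫ : ℝ) : ℂ)) *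
        (b p.1 * (starRingEnd ℂ) (b p.2)) = (cexp (I * ((⟪t, p.1⟫ : ℝ) : ℂ)) * b p.1) *
        (starRingEnd ℂ) (cexp (I * ((⟪t, p.2⟫ : ℝ) : ℂ)) * b p.2) := by
      intro p
      rw [map_mul, ← Complex.exp_conj, map_mul, Complex.conj_I, Complex.conj_ofReal]
      have : I * ((⟪t, p.1 - p.2⟫ : ℝ) : ℂ) = I * ((⟪t, p.1⟫ : ℝ) : ℂ) +
        -I * ((⟪t, p.2⟫ : ℝ) : ℂ) := by rw [inner_sub_right]; push_cast; ring
      rw [this, Complex.exp_add]; ring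
    simp_rw [e1]
    rw [integral_prod_mul (fun x => cexp (I * ((⟪t, x⟫ : ℝ) : ℂ)) * b x)
      (fun x => (starRingEnd ℂ) (cexp (I * ((⟪t, x⟫ : ℝ) : ℂ)) * b x)), integral_conj,
      Complex.mul_conj, Complex.normSq_eq_norm_sq]
    rw [Complex.ofReal_mul, Complex.ofReal_exp]
    congr 2
    push_cast
    ring
  have hR : Integrable (fun t => Real.exp (-ε * ‖t‖ ^ 2) * ‖g t‖ ^ 2) := by
    have := hHint.integral_prod_left
    simp_rw [hmod] at this
    exact (this.re).congr (Filter.Eventually.of_forall fun t => Complex.ofReal_re _)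
  have hL : ∫⁻ t : E3, ENNReal.ofReal (Real.exp (-ε * ‖t‖ ^ 2)) * ‖g t‖ₑ ^ 2 =
      ‖∫ q, H q ∂(volume.prod (volume.prod volume))‖ₑ := by
    rw [integral_prod _ hHint]
    simp_rw [hmod]
    rw [integral_complex_ofReal, ← ofReal_norm, Complex.norm_real, Real.norm_of_nonneg
      (integral_nonneg fun t => by positivity), ofReal_integral_eq_lintegral_ofReal hR
      (Filter.Eventually.of_forall fun t => by positivity)]
    refine lintegral_congr fun t => ?_
    rw [ENNReal.ofReal_mul (Real.exp_pos _).le, ENNReal.ofReal_pow (norm_nonneg _),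
      ofReal_norm]
  rw [hL, integral_prod_symm _ hHint]
  refine (enorm_integral_le_lintegral_enorm _).trans ?_
  set K : E3 → ℂ := fun τ => (Real.pi / ε : ℂ) ^ (3 / 2 : ℂ) * cexp (I ^ 2 * (‖τ‖ : ℂ) ^ 2 / (4 * ε))
    with hK
  have hin : ∀ p : E3 × E3, ‖∫ t, H (t, p)‖ₑ = ‖b p.1‖ₑ * ‖b p.2‖ₑ * ‖K (p.1 - p.2)‖ₑ := by
    intro p
    have e2 : ∀ t : E3, H (t, p) = cexp (-ε * (‖t‖ : ℂ) ^ 2 + I * ((⟪p.1 - p.2, t⟫ : ℝ) : ℂ)) *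
        (b p.1 * (starRingEnd ℂ) (b p.2)) := by
      intro t
      simp only [hH]
      rw [Complex.exp_add, real_inner_comm, mul_assoc]
    simp_rw [e2]
    rw [integral_mul_const, GaussianFourier.integral_cexp_neg_mul_sq_norm_add (by simpa using hε),
      enorm_mul, mul_comm]
    congr 1
    · rw [enorm_mul]
      congr 1
      rw [← ofReal_norm, RCLike.norm_conj, ofReal_norm]
    · simp only [hK, finrank_euclideanSpace_fin]
      push_cast
      rfl
  simp_rw [hin]
  apply schur_gen volume hb (k := fun p => ‖K (p.1 - p.2)‖ₑ)
  · simp only [hK]; fun_prop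
  · intro x y; simp only [hK]; rw [norm_sub_rev]
  · intro τ
    exact (gauss_lintegral3 hε τ).le

lemma space_planch {b : E3 → ℂ} (hb : Integrable b) :
    ∫⁻ t : E3, ‖∫ x, cexp (I * ((⟪t, x⟫ : ℝ) : ℂ)) * b x‖ₑ ^ 2 ≤
      ENNReal.ofReal ((2 * Real.pi) ^ 3) * ∫⁻ x, ‖b x‖ₑ ^ 2 := by
  set g : E3 → ℂ := fun t => ∫ x, cexp (I * ((⟪t, x⟫ : ℝ) : ℂ)) * b x with hg
  have hgm : AEMeasurable (fun t => ‖g t‖ₑ ^ 2) := by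
    refine AEMeasurable.pow_const ?_ 2
    refine AEStronglyMeasurable.enorm ?_
    have : AEStronglyMeasurable (fun q : E3 × E3 => cexp (I * ((⟪q.1, q.2⟫ : ℝ) : ℂ)) * b q.2)
        (volume.prod volume) := by
      apply AEStronglyMeasurable.mul
      · apply Continuous.aestronglyMeasurable; fun_prop
      · exact hb.1.comp_snd
    exact this.integral_prod_right'
  have hlim := lintegral_tendsto_of_tendsto_of_monotone (μ := volume)
    (f := fun (n : ℕ) (t : E3) => ENNReal.ofReal (Real.exp (-(1 / ((n : ℝ) + 1)) * ‖t‖ ^ 2)) *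
      ‖g t‖ₑ ^ 2) (F := fun t => ‖g t‖ₑ ^ 2) ?_ ?_ ?_
  · exact le_of_tendsto' hlim fun n => space_reg hb (by positivity)
  · intro n
    apply AEMeasurable.mul _ hgm
    apply Measurable.aemeasurable; fun_prop
  · apply Filter.Eventually.of_forall
    intro t n m hnm
    simp only
    have : (1 / ((m : ℝ) + 1)) ≤ 1 / ((n : ℝ) + 1) := by gcongr
    gcongr
  · apply Filter.Eventually.of_forall
    intro t
    have h1 : Filter.Tendsto (fun n : ℕ => ENNReal.ofReal (Real.exp (-(1 / ((n : ℝ) + 1)) * ‖t‖ ^ 2)))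
        Filter.atTop (nhds 1) := by
      rw [← ENNReal.ofReal_one, ← Real.exp_zero]
      apply ENNReal.tendsto_ofReal
      apply (Real.continuous_exp.tendsto _).comp
      have := (tendsto_one_div_add_atTop_nhds_zero_nat (𝕜 := ℝ)).neg.mul_const (‖t‖ ^ 2)
      simpa using this
    have := ENNReal.Tendsto.mul_const (b := ‖g t‖ₑ ^ 2) h1 (Or.inl one_ne_zero)
    simpa using this



/-- Oscillatory extension operator. -/
def ext3 (P : E3 → ℝ) (h : E3 → ℂ) (t : ℝ) (x : E3) : ℂ :=
  ∫ ξ, cexp (I * ((⟪x, ξ⟫ + t * P ξ : ℝ) : ℂ)) * h ξ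

lemma shear_mp : MeasurePreserving
    (fun q : (E3 × E3) × E3 => (q.1, q.2 - q.1.1 - q.1.2)) := by
  refine MeasurePreserving.skew_product (MeasurePreserving.id (volume : Measure (E3 × E3)))
    (g := fun (a : E3 × E3) (z : E3) => z - a.1 - a.2) ?_ ?_
  · unfold Function.uncurry; fun_prop
  · refine Filter.Eventually.of_forall fun a => ?_
    simp_rw [sub_sub]
    exact (measurePreserving_sub_right volume (a.1 + a.2)).map_eq

lemma norm_cexp_I (r : ℝ) : ‖cexp (I * (r : ℂ))‖ = 1 := by
  rw [mul_comm I, Complex.norm_exp_ofReal_mul_I]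

lemma integrable_osc {X : Type*} [MeasurableSpace X] {μ : Measure X} {f : X → ℂ}
    (hf : Integrable f μ) {φ : X → ℝ} (hφ : Measurable φ) :
    Integrable (fun x => cexp (I * ((φ x : ℝ) : ℂ)) * f x) μ := by
  apply hf.bdd_mul (c := 1)
  · apply Measurable.aestronglyMeasurable; fun_prop
  · exact Filter.Eventually.of_forall fun q => (norm_cexp_I _).le

lemma trilinear {P : E3 → ℝ} (hP : Measurable P) {S : Set E3} {L : E3 ≃ₗᵢ[ℝ] E3} {c : ℝ}
    (hc : 0 < c) (hG : GoodCone P S L c) {R1 R2 R3 : ℝ} (hR1 : 0 < R1) (hR2 : 0 < R2) (hR3 : 0 < R3)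
    {h1 h2 h3 : E3 → ℂ} (m1 : Measurable h1) (m2 : Measurable h2) (m3 : Measurable h3)
    (i1 : Integrable h1) (i2 : Integrable h2) (i3 : Integrable h3)
    (s1 : ∀ ξ, h1 ξ ≠ 0 → ξ ∈ S ∧ ‖ξ‖ ≤ R1) (s2 : ∀ ξ, h2 ξ ≠ 0 → ξ ∈ S ∧ ‖ξ‖ ≤ R2)
    (s3 : ∀ ξ, h3 ξ ≠ 0 → ξ ∈ S ∧ ‖ξ‖ ≤ R3) :
    ∫⁻ t : ℝ, ∫⁻ x : E3, ‖ext3 P h1 t x * (ext3 P h2 t x * ext3 P h3 t x)‖ₑ ^ 2 ≤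
      ENNReal.ofReal ((2 * Real.pi) ^ 3) * (ENNReal.ofReal (2 * Real.pi *
        (32 * Real.pi / c ^ 2 * R2 ^ 3 * R3 ^ 3)) *
      ((∫⁻ x, ‖h1 x‖ₑ ^ 2) * ((∫⁻ x, ‖h2 x‖ₑ ^ 2) * ∫⁻ x, ‖h3 x‖ₑ ^ 2))) := by
  set G : (E3 × E3) × E3 → ℂ := fun q => (h2 q.1.1 * h3 q.1.2) * h1 q.2 with hGdef
  have hGi : Integrable G (volume.prod volume) := (i2.mul_prod i3).mul_prod i1
  set T : (E3 × E3) × E3 → (E3 × E3) × E3 := fun q => (q.1, q.2 - q.1.1 - q.1.2) with hT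
  have hTm : Measurable T := shear_mp.measurable
  set H : (E3 × E3) × E3 → ℂ := fun q => G (T q) with hH
  have hGm : Measurable G := by simp only [hGdef]; fun_prop
  have hHm : Measurable H := hGm.comp hTm
  have hHi : Integrable H (volume.prod volume) := shear_mp.integrable_comp_of_integrable hGi
  set Φ : (E3 × E3) × E3 → ℝ := fun q => P (q.2 - q.1.1 - q.1.2) + P q.1.1 + P q.1.2 with hΦ
  have hΦm : Measurable Φ := by simp only [hΦ]; fun_prop
  set A : ℝ → E3 → ℂ := fun t ζ => ∫ w, cexp (I * ((t * Φ (w, ζ) : ℝ) : ℂ)) * H (w, ζ) with hA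
  have hprod : ∀ t x, ext3 P h1 t x * (ext3 P h2 t x * ext3 P h3 t x) =
      ∫ ζ, cexp (I * ((⟪x, ζ⟫ : ℝ) : ℂ)) * A t ζ := by
    intro t x
    have e1 : ext3 P h1 t x * (ext3 P h2 t x * ext3 P h3 t x) =
        ∫ q : (E3 × E3) × E3, (fun q : (E3 × E3) × E3 =>
          cexp (I * ((⟪x, q.1.1 + q.1.2 + q.2⟫ + t * (P q.2 + P q.1.1 + P q.1.2) : ℝ) : ℂ)) * G q) q
          ∂(volume.prod volume) := by
      unfold ext3
      rw [mul_comm, ← integral_prod_mul, ← integral_prod_mul]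
      refine integral_congr_ae (Filter.Eventually.of_forall fun q => ?_)
      simp only [hGdef]
      have : I * ((⟪x, q.1.1 + q.1.2 + q.2⟫ + t * (P q.2 + P q.1.1 + P q.1.2) : ℝ) : ℂ) =
        I * ((⟪x, q.1.1⟫ + t * P q.1.1 : ℝ) : ℂ) + I * ((⟪x, q.1.2⟫ + t * P q.1.2 : ℝ) : ℂ) +
        I * ((⟪x, q.2⟫ + t * P q.2 : ℝ) : ℂ) := by
        rw [inner_add_right, inner_add_right]; push_cast; ring
      rw [this, Complex.exp_add, Complex.exp_add]
      ring
    rw [e1]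
    have e2 := shear_mp.integral_comp' (f := MeasurableEquiv.mk
      (Equiv.mk T (fun q => (q.1, q.2 + q.1.1 + q.1.2)) (fun q => Prod.ext rfl (by simp only [hT]; abel)) (fun q => Prod.ext rfl (by simp only [hT]; abel)))
      hTm (by simp only [Equiv.coe_fn_symm_mk]; fun_prop)) (fun q : (E3 × E3) × E3 =>
          cexp (I * ((⟪x, q.1.1 + q.1.2 + q.2⟫ + t * (P q.2 + P q.1.1 + P q.1.2) : ℝ) : ℂ)) * G q)
    rw [← Measure.volume_eq_prod, ← e2, Measure.volume_eq_prod, integral_prod_symm]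
    · refine integral_congr_ae (Filter.Eventually.of_forall fun ζ => ?_)
      simp only [hA]
      rw [← integral_const_mul]
      refine integral_congr_ae (Filter.Eventually.of_forall fun w => ?_)
      simp only [MeasurableEquiv.coe_mk, Equiv.coe_fn_mk, hH, hT, hΦ]
      rw [← mul_assoc (cexp (I * ((⟪x, ζ⟫ : ℝ) : ℂ))), ← Complex.exp_add,
        show w.1 + w.2 + (ζ - w.1 - w.2) = ζ by abel, ← mul_add, ← Complex.ofReal_add]
    · have := integrable_osc hHi (φ := fun q => ⟪x, (T q).1.1 + (T q).1.2 + (T q).2⟫ + t *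
        (P (T q).2 + P (T q).1.1 + P (T q).1.2)) (by fun_prop)
      exact this
  have hAi : ∀ t, Integrable (A t) := fun t =>
    (integrable_osc hHi (φ := fun q => t * Φ q) (by fun_prop)).integral_prod_right
  have hAm : Measurable (fun q : ℝ × E3 => A q.1 q.2) := by
    have : StronglyMeasurable (fun r : (ℝ × E3) × (E3 × E3) =>
        cexp (I * ((r.1.1 * Φ (r.2, r.1.2) : ℝ) : ℂ)) * H (r.2, r.1.2)) := by
      apply Measurable.stronglyMeasurable; fun_prop
    exact this.integral_prod_right'.measurable
  simp_rw [hprod]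
  calc _ ≤ ∫⁻ t : ℝ, ENNReal.ofReal ((2 * Real.pi) ^ 3) * ∫⁻ ζ, ‖A t ζ‖ₑ ^ 2 :=
        lintegral_mono fun t => space_planch (hAi t)
    _ = ENNReal.ofReal ((2 * Real.pi) ^ 3) * ∫⁻ ζ, ∫⁻ t, ‖A t ζ‖ₑ ^ 2 := by
        rw [lintegral_const_mul', lintegral_lintegral_swap]
        · apply Measurable.aemeasurable
          exact hAm.enorm.pow_const 2
        · exact ENNReal.ofReal_ne_top
    _ ≤ ENNReal.ofReal ((2 * Real.pi) ^ 3) * ∫⁻ ζ, ENNReal.ofReal (2 * Real.pi *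
        (32 * Real.pi / c ^ 2 * R2 ^ 3 * R3 ^ 3)) * ∫⁻ w, ‖H (w, ζ)‖ₑ ^ 2 := by
        gcongr 1
        apply lintegral_mono_ae
        filter_upwards [hHi.prod_left_ae] with ζ hζ
        set D : Set (E3 × E3) := {w : E3 × E3 | ((w.1 ∈ S ∧ ‖w.1‖ ≤ R2) ∧ (w.2 ∈ S ∧ ‖w.2‖ ≤ R3)) ∧
          (ζ - w.1 - w.2 ∈ S ∧ ‖ζ - w.1 - w.2‖ ≤ R1)} with hD
        have hz : ∀ w, w ∉ D → H (w, ζ) = 0 := by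
          intro w hw
          by_contra hne
          simp only [hH, hT, hGdef, mul_ne_zero_iff] at hne
          exact hw ⟨⟨s2 _ hne.1.1, s3 _ hne.1.2⟩, s1 _ hne.2⟩
        have hAD : ∀ t, A t ζ = ∫ w in D, cexp (I * ((t * Φ (w, ζ) : ℝ) : ℂ)) * H (w, ζ) := by
          intro t
          rw [setIntegral_eq_integral_of_forall_compl_eq_zero]
          intro w hw
          rw [hz w hw, mul_zero]
        simp_rw [hAD]
        refine (time_planch (volume.restrict D) (F := fun w => Φ (w, ζ)) (by fun_prop)
          (M := 32 * Real.pi / c ^ 2 * R2 ^ 3 * R3 ^ 3) (by positivity) ?_ hζ.restrict).trans ?_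
        · intro a δ hδ
          rw [Measure.restrict_apply, Set.inter_comm]
          · exact slice6 hP hc hG hR1 hR2 hR3 ζ a δ hδ
          · apply measurableSet_preimage _ measurableSet_Icc
            fun_prop
        · gcongr
          exact Measure.restrict_le_self
    _ = _ := by
        rw [lintegral_const_mul']
        · congr 2
          have hmm : Measurable (fun q => ‖H q‖ₑ ^ 2) := hHm.enorm.pow_const 2
          rw [← lintegral_prod_symm' (fun q => ‖H q‖ₑ ^ 2) hmm]
          have e3 := shear_mp.lintegral_comp (f := fun q => ‖G q‖ₑ ^ 2) (hGm.enorm.pow_const 2)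
          rw [← Measure.volume_eq_prod]
          refine e3.trans ?_
          simp only [hGdef, enorm_mul, mul_pow]
          rw [Measure.volume_eq_prod, lintegral_prod_mul (f := fun w : E3 × E3 =>
            ‖h2 w.1‖ₑ ^ 2 * ‖h3 w.2‖ₑ ^ 2) (g := fun x => ‖h1 x‖ₑ ^ 2)]
          · rw [mul_comm, Measure.volume_eq_prod, lintegral_prod_mul (f := fun w : E3 =>
              ‖h2 w‖ₑ ^ 2) (g := fun x => ‖h3 x‖ₑ ^ 2)]
            · exact (m2.enorm.pow_const 2).aemeasurable
            · exact (m3.enorm.pow_const 2).aemeasurable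
          · apply Measurable.aemeasurable
            fun_prop
          · exact (m1.enorm.pow_const 2).aemeasurable
        · exact ENNReal.ofReal_ne_top



lemma mink {X Y : Type*} [MeasurableSpace X] [MeasurableSpace Y] (μ : Measure X) (ν : Measure Y)
    [SFinite μ] [SFinite ν] {F : X → Y → ℝ≥0∞} (hF : Measurable (Function.uncurry F))
    {b : X → ℝ≥0∞} (hb : Measurable b) {p : ℝ} (hp : 1 < p)
    (h : ∀ x, ∫⁻ y, F x y ^ p ∂ν ≤ b x ^ p) :
    ∫⁻ y, (∫⁻ x, F x y ∂μ) ^ p ∂ν ≤ (∫⁻ x, b x ∂μ) ^ p := by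
  have hp0 : 0 < p := by linarith
  set B := ∫⁻ x, b x ∂μ with hB
  rcases eq_or_ne B ⊤ with hBt | hBt
  · rw [hBt, ENNReal.top_rpow_of_pos hp0]; exact le_top
  have hbfin : ∀ᵐ x ∂μ, b x < ⊤ := ae_lt_top hb hBt
  have hz : ∀ᵐ x ∂μ, ∀ᵐ y ∂ν, (b x = 0 → F x y = 0) := by
    refine Filter.Eventually.of_forall fun x => ?_
    by_cases hx : b x = 0
    · have h1 := h x
      rw [hx, ENNReal.zero_rpow_of_pos hp0, nonpos_iff_eq_zero, lintegral_eq_zero_iff] at h1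
      · filter_upwards [h1] with y hy _
        simpa [ENNReal.rpow_eq_zero_iff, hp0, hp0.not_gt] using hy
      · exact (hF.comp measurable_prodMk_left).pow_const p
    · exact Filter.Eventually.of_forall fun y hy => absurd hy hx
  have hms : MeasurableSet {q : X × Y | b q.1 = 0 → F q.1 q.2 = 0} := by
    have h1 : MeasurableSet {q : X × Y | b q.1 = 0} :=
      (hb.comp measurable_fst) (measurableSet_singleton 0)
    have h2 : MeasurableSet {q : X × Y | F q.1 q.2 = 0} := hF (measurableSet_singleton 0)
    exact h1.imp h2
  rw [Measure.ae_ae_comm hms] at hz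
  set q := p / (p - 1) with hq
  have hpq : p.HolderConjugate q := Real.HolderConjugate.conjExponent hp
  have hq0 : 0 < q := hpq.symm.pos
  have hqi : 1 / q = (p - 1) / p := by rw [hq, one_div_div]
  have key : ∀ᵐ y ∂ν, (∫⁻ x, F x y ∂μ) ^ p ≤ B ^ (p - 1) * ∫⁻ x, F x y ^ p * b x ^ (1 - p) ∂μ := by
    filter_upwards [hz] with y hy
    have e1 : ∫⁻ x, F x y ∂μ ≤
        (∫⁻ x, (F x y * b x ^ (-(1 / q))) ^ p ∂μ) ^ (1 / p) * (∫⁻ x, (b x ^ (1 / q)) ^ q ∂μ) ^ (1 / q) := by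
      refine le_trans (lintegral_mono_ae ?_) (ENNReal.lintegral_mul_le_Lp_mul_Lq μ hpq
        (f := fun x => F x y * b x ^ (-(1 / q))) (g := fun x => b x ^ (1 / q)) ?_ ?_)
      · filter_upwards [hy, hbfin] with x hx hx'
        simp only [Pi.mul_apply]
        by_cases h0 : b x = 0
        · rw [hx h0]; exact zero_le
        · rw [mul_assoc, ← ENNReal.rpow_add _ _ h0 hx'.ne]; simp
      · apply Measurable.aemeasurable
        exact (hF.comp measurable_prodMk_right).mul (hb.pow_const _)
      · exact (hb.pow_const _).aemeasurable
    have e2 : ∀ x, (F x y * b x ^ (-(1 / q))) ^ p = F x y ^ p * b x ^ (1 - p) := by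
      intro x
      rw [ENNReal.mul_rpow_of_nonneg _ _ hp0.le, ← ENNReal.rpow_mul]
      congr 2
      rw [hqi]; field_simp; ring
    have e3 : ∀ x, (b x ^ (1 / q)) ^ q = b x := by
      intro x
      rw [← ENNReal.rpow_mul, one_div, inv_mul_cancel₀ hq0.ne', ENNReal.rpow_one]
    simp_rw [e2, e3] at e1
    calc _ ≤ ((∫⁻ x, F x y ^ p * b x ^ (1 - p) ∂μ) ^ (1 / p) * B ^ (1 / q)) ^ p :=
          ENNReal.rpow_le_rpow e1 hp0.le
      _ = _ := by
          rw [ENNReal.mul_rpow_of_nonneg _ _ hp0.le, ← ENNReal.rpow_mul, ← ENNReal.rpow_mul,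
            one_div, inv_mul_cancel₀ hp0.ne', ENNReal.rpow_one, mul_comm, hqi]
          congr 2
          field_simp
  have hm2 : Measurable (Function.uncurry fun (y : Y) (x : X) => F x y ^ p * b x ^ (1 - p)) := by
    apply Measurable.mul
    · exact (hF.comp measurable_swap).pow_const p
    · exact (hb.comp measurable_snd).pow_const _
  calc _ ≤ ∫⁻ y, B ^ (p - 1) * ∫⁻ x, F x y ^ p * b x ^ (1 - p) ∂μ ∂ν := lintegral_mono_ae key
    _ = B ^ (p - 1) * ∫⁻ x, ∫⁻ y, F x y ^ p * b x ^ (1 - p) ∂ν ∂μ := by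
        rw [lintegral_const_mul, lintegral_lintegral_swap hm2.aemeasurable]
        exact hm2.lintegral_prod_right'
    _ ≤ B ^ (p - 1) * ∫⁻ x, b x ∂μ := by
        gcongr with x
        have hmx : Measurable (fun y => F x y ^ p) := (hF.comp measurable_prodMk_left).pow_const p
        rw [lintegral_mul_const _ hmx]
        calc _ ≤ b x ^ p * b x ^ (1 - p) := by gcongr; exact h x
          _ ≤ b x := by
            rcases eq_or_ne (b x) 0 with h0 | h0
            · rw [h0, ENNReal.zero_rpow_of_pos hp0, zero_mul]
            rcases eq_or_ne (b x) ⊤ with ht | ht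
            · rw [ht]; exact le_top
            rw [← ENNReal.rpow_add _ _ h0 ht]
            simp
    _ = B ^ p := by
        rw [← hB]
        rcases eq_or_ne B 0 with h0 | h0
        · rw [h0, ENNReal.zero_rpow_of_pos hp0, mul_zero]
        nth_rewrite 2 [← ENNReal.rpow_one B]
        rw [← ENNReal.rpow_add _ _ h0 hBt]
        simp



lemma tsum_le_diag (v : ℤ → ℝ≥0∞) (a : ℤ) :
    ∑' b : ℤ, (if b ≤ a then v b else 0) = ∑' i : ℕ, v (a - i) := by
  have hinj : Function.Injective (fun i : ℕ => a - (i : ℤ)) := by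
    intro i j hij
    simpa using hij
  rw [← hinj.tsum_eq (f := fun b : ℤ => if b ≤ a then v b else 0)]
  · refine tsum_congr fun i => ?_
    rw [if_pos (by omega)]
  · intro b hb
    have : b ≤ a := by
      by_contra hba
      simp [hba] at hb
    exact ⟨(a - b).toNat, by simp only; omega⟩

lemma cube_tsum_le (v : ℤ → ℝ≥0∞) :
    (∑' a, v a) ^ 3 ≤ 3 * ∑' a : ℤ, ∑' i : ℕ, ∑' j : ℕ, v a * (v (a - i) * v (a - j)) := by
  set W : ℤ → ℤ → ℤ → ℝ≥0∞ := fun a b c => v a * ((if b ≤ a then v b else 0) *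
    (if c ≤ a then v c else 0)) with hW
  have hS : ∑' a : ℤ, ∑' i : ℕ, ∑' j : ℕ, v a * (v (a - i) * v (a - j)) =
      ∑' a, ∑' b, ∑' c, W a b c := by
    refine tsum_congr fun a => ?_
    simp only [hW, ENNReal.tsum_mul_left, ENNReal.tsum_mul_right, tsum_le_diag]
  rw [hS]
  have hcube : (∑' a, v a) ^ 3 = ∑' a, ∑' b, ∑' c, v a * (v b * v c) := by
    simp only [ENNReal.tsum_mul_left, ENNReal.tsum_mul_right]
    ring
  rw [hcube]
  have hle : ∀ a b c, v a * (v b * v c) ≤ W a b c + (W b a c + W c a b) := by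
    intro a b c
    simp only [hW]
    rcases le_total b a with hba | hba
    · rcases le_total c a with hca | hca
      · simp [hba, hca]
      · have : b ≤ c := hba.trans hca
        simp only [hca, this, if_true]
        refine le_trans (le_of_eq ?_) (le_trans le_add_self le_add_self)
        ring
    · rcases le_total c b with hcb | hcb
      · simp only [hba, hcb, if_true]
        refine le_trans (le_of_eq ?_) (le_trans le_self_add le_add_self)
        ring
      · have : a ≤ c := hba.trans hcb
        simp only [hcb, this, if_true]
        refine le_trans (le_of_eq ?_) (le_trans le_add_self le_add_self)
        ring
  calc _ ≤ ∑' a, ∑' b, ∑' c, (W a b c + (W b a c + W c a b)) :=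
        ENNReal.tsum_le_tsum fun a => ENNReal.tsum_le_tsum fun b => ENNReal.tsum_le_tsum fun c =>
          hle a b c
    _ = ∑' a, ∑' b, ∑' c, W a b c + (∑' a, ∑' b, ∑' c, W b a c + ∑' a, ∑' b, ∑' c, W c a b) := by
        simp only [ENNReal.tsum_add]
    _ = _ := by
        have e1 : ∑' a, ∑' b, ∑' c, W b a c = ∑' a, ∑' b, ∑' c, W a b c := ENNReal.tsum_comm
        have e2 : ∑' a, ∑' b, ∑' c, W c a b = ∑' a, ∑' b, ∑' c, W a b c := by
          rw [show (∑' a, ∑' b, ∑' c, W c a b) = ∑' a, ∑' c, ∑' b, W c a b from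
            tsum_congr fun a => ENNReal.tsum_comm]
          exact ENNReal.tsum_comm
        rw [e1, e2]; ring

/-- dyadic annulus -/
def ann (k : ℤ) : Set E3 := {ξ | (2 : ℝ) ^ k ≤ ‖ξ‖ ∧ ‖ξ‖ < (2 : ℝ) ^ (k + 1)}

lemma ann_meas (k : ℤ) : MeasurableSet (ann k) := by
  apply MeasurableSet.inter
  · exact measurableSet_le measurable_const measurable_norm
  · exact measurableSet_lt measurable_norm measurable_const

lemma ann_disj : Pairwise (Function.onFun Disjoint ann) := by
  have key : ∀ i j : ℤ, i < j → Disjoint (ann i) (ann j) := by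
    intro i j hij
    rw [Set.disjoint_left]
    rintro ξ ⟨_, h1⟩ ⟨h2, _⟩
    have : (2 : ℝ) ^ (i + 1) ≤ 2 ^ j := zpow_le_zpow_right₀ (by norm_num) (by omega)
    linarith
  intro i j hij
  rcases lt_or_gt_of_ne hij with h | h
  · exact key i j h
  · exact (key j i h).symm

lemma ann_union : (⋃ k, ann k) = {(0 : E3)}ᶜ := by
  ext ξ
  simp only [Set.mem_iUnion, Set.mem_compl_iff, Set.mem_singleton_iff]
  constructor
  · rintro ⟨k, hk, _⟩ rfl
    have : (0 : ℝ) < 2 ^ k := by positivity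
    rw [norm_zero] at hk
    linarith
  · intro h
    obtain ⟨n, hn⟩ := exists_mem_Ico_zpow (norm_pos_iff.2 h) (one_lt_two (α := ℝ))
    exact ⟨n, hn⟩

lemma ext3_dyadic {P : E3 → ℝ} (hP : Measurable P) {h : E3 → ℂ} (hi : Integrable h) (t : ℝ) (x : E3) :
    ‖ext3 P h t x‖ₑ ≤ ∑' k, ‖ext3 P ((ann k).indicator h) t x‖ₑ := by
  have hint := integrable_osc hi (φ := fun ξ => ⟪x, ξ⟫ + t * P ξ) (by fun_prop)
  have hs := hasSum_integral_iUnion ann_meas ann_disj (hint.integrableOn (s := ⋃ k, ann k))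
  have e1 : ∀ k, ext3 P ((ann k).indicator h) t x =
      ∫ ξ in ann k, cexp (I * ((⟪x, ξ⟫ + t * P ξ : ℝ) : ℂ)) * h ξ := by
    intro k
    unfold ext3
    rw [← integral_indicator (ann_meas k)]
    refine integral_congr_ae (Filter.Eventually.of_forall fun ξ => ?_)
    by_cases hξ : ξ ∈ ann k <;> simp [hξ]
  have e2 : ext3 P h t x = ∫ ξ in ⋃ k, ann k, cexp (I * ((⟪x, ξ⟫ + t * P ξ : ℝ) : ℂ)) * h ξ := by
    rw [ann_union, setIntegral_eq_integral_of_ae_compl_eq_zero]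
    · rfl
    · have : ∀ᵐ ξ : E3, ξ ≠ 0 := by
        simp [ae_iff]
      filter_upwards [this] with ξ h1 h2
      exact absurd h1 (by simpa using h2)
  simp_rw [e1]
  rw [e2, ← hs.tsum_eq]
  exact enorm_tsum_le_tsum_enorm

lemma ext3_meas {P : E3 → ℝ} (hP : Measurable P) {h : E3 → ℂ} (hm : Measurable h) :
    Measurable (fun q : ℝ × E3 => ext3 P h q.1 q.2) := by
  have : StronglyMeasurable (fun r : (ℝ × E3) × E3 =>
      cexp (I * ((⟪r.1.2, r.2⟫ + r.1.1 * P r.2 : ℝ) : ℂ)) * h r.2) := by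
    apply Measurable.stronglyMeasurable; fun_prop
  exact this.integral_prod_right'.measurable

lemma weight_le {h : E3 → ℂ} (k : ℤ) :
    ∫⁻ ξ, ‖(ann k).indicator h ξ‖ₑ ^ 2 ≤
      ENNReal.ofReal (((2 : ℝ) ^ k) ^ 2)⁻¹ * ∫⁻ ξ in ann k, ‖ξ‖ₑ ^ 2 * ‖h ξ‖ₑ ^ 2 := by
  rw [← lintegral_const_mul' _ _ ENNReal.ofReal_ne_top, ← lintegral_indicator (ann_meas k)]
  apply lintegral_mono
  intro ξ
  by_cases hξ : ξ ∈ ann k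
  · simp only [Set.indicator_of_mem hξ]
    rw [← mul_assoc, ← ofReal_norm ξ, ← ENNReal.ofReal_pow (norm_nonneg _),
      ← ENNReal.ofReal_mul (by positivity)]
    refine le_mul_of_one_le_left zero_le ?_
    rw [ENNReal.one_le_ofReal]
    have h2 : (0 : ℝ) < 2 ^ k := by positivity
    rw [inv_mul_eq_div, one_le_div (by positivity)]
    have := hξ.1
    gcongr
  · simp [hξ]



lemma triple_bound {P : E3 → ℝ} (hP : Measurable P) {S : Set E3} {L : E3 ≃ₗᵢ[ℝ] E3} {c : ℝ}
    (hc : 0 < c) (hG : GoodCone P S L c) {h : E3 → ℂ} (hm : Measurable h) (hi : Integrable h)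
    (hs : ∀ ξ, h ξ ≠ 0 → ξ ∈ S) (a : ℤ) (i j : ℕ) :
    ∫⁻ q : ℝ × E3, ‖ext3 P ((ann a).indicator h) q.1 q.2 *
      (ext3 P ((ann (a - i)).indicator h) q.1 q.2 *
        ext3 P ((ann (a - j)).indicator h) q.1 q.2)‖ₑ ^ 2 ∂(volume.prod volume) ≤
      ENNReal.ofReal ((2 * Real.pi) ^ 3 * (2 * Real.pi * (32 * Real.pi / c ^ 2 * 64)) *
        ((1 / 2) ^ i * (1 / 2) ^ j)) *
      ((∫⁻ ξ in ann a, ‖ξ‖ₑ ^ 2 * ‖h ξ‖ₑ ^ 2) * ((∫⁻ ξ in ann (a - i), ‖ξ‖ₑ ^ 2 * ‖h ξ‖ₑ ^ 2) *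
        ∫⁻ ξ in ann (a - j), ‖ξ‖ₑ ^ 2 * ‖h ξ‖ₑ ^ 2)) := by
  have hmk : ∀ k, Measurable ((ann k).indicator h) := fun k => hm.indicator (ann_meas k)
  have hik : ∀ k, Integrable ((ann k).indicator h) := fun k => hi.indicator (ann_meas k)
  have hsk : ∀ k ξ, (ann k).indicator h ξ ≠ 0 → ξ ∈ S ∧ ‖ξ‖ ≤ (2 : ℝ) ^ (k + 1) := by
    intro k ξ hξ
    have h1 : ξ ∈ ann k := Set.mem_of_indicator_ne_zero hξ
    rw [Set.indicator_of_mem h1] at hξ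
    exact ⟨hs ξ hξ, h1.2.le⟩
  rw [lintegral_prod]
  swap
  · apply Measurable.aemeasurable
    have := ((ext3_meas hP (hmk a)).mul ((ext3_meas hP (hmk (a - i))).mul
      (ext3_meas hP (hmk (a - j))))).enorm.pow_const 2
    exact this
  refine (trilinear hP hc hG (R1 := (2 : ℝ) ^ (a + 1)) (R2 := (2 : ℝ) ^ (a - i + 1))
    (R3 := (2 : ℝ) ^ (a - j + 1)) (by positivity) (by positivity) (by positivity)
    (hmk _) (hmk _) (hmk _) (hik _) (hik _) (hik _) (hsk _) (hsk _) (hsk _)).trans ?_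
  have hz : ∀ k : ℤ, (0 : ℝ) < 2 ^ k := fun k => by positivity
  calc _ ≤ ENNReal.ofReal ((2 * Real.pi) ^ 3) * (ENNReal.ofReal (2 * Real.pi *
        (32 * Real.pi / c ^ 2 * ((2 : ℝ) ^ (a - i + 1)) ^ 3 * ((2 : ℝ) ^ (a - j + 1)) ^ 3)) *
      ((ENNReal.ofReal (((2 : ℝ) ^ a) ^ 2)⁻¹ * ∫⁻ ξ in ann a, ‖ξ‖ₑ ^ 2 * ‖h ξ‖ₑ ^ 2) *
      ((ENNReal.ofReal (((2 : ℝ) ^ (a - i)) ^ 2)⁻¹ * ∫⁻ ξ in ann (a - i), ‖ξ‖ₑ ^ 2 * ‖h ξ‖ₑ ^ 2) *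
      (ENNReal.ofReal (((2 : ℝ) ^ (a - j)) ^ 2)⁻¹ *
        ∫⁻ ξ in ann (a - j), ‖ξ‖ₑ ^ 2 * ‖h ξ‖ₑ ^ 2)))) := by
        gcongr
        · exact weight_le a
        · exact weight_le (a - i)
        · exact weight_le (a - j)
    _ = (ENNReal.ofReal ((2 * Real.pi) ^ 3) * (ENNReal.ofReal (2 * Real.pi *
        (32 * Real.pi / c ^ 2 * ((2 : ℝ) ^ (a - i + 1)) ^ 3 * ((2 : ℝ) ^ (a - j + 1)) ^ 3)) *
      (ENNReal.ofReal (((2 : ℝ) ^ a) ^ 2)⁻¹ * (ENNReal.ofReal (((2 : ℝ) ^ (a - i)) ^ 2)⁻¹ *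
       ENNReal.ofReal (((2 : ℝ) ^ (a - j)) ^ 2)⁻¹)))) *
      ((∫⁻ ξ in ann a, ‖ξ‖ₑ ^ 2 * ‖h ξ‖ₑ ^ 2) * ((∫⁻ ξ in ann (a - i), ‖ξ‖ₑ ^ 2 * ‖h ξ‖ₑ ^ 2) *
        ∫⁻ ξ in ann (a - j), ‖ξ‖ₑ ^ 2 * ‖h ξ‖ₑ ^ 2)) := by ring
    _ = _ := by
        congr 1
        rw [← ENNReal.ofReal_mul (by positivity), ← ENNReal.ofReal_mul (by positivity),
          ← ENNReal.ofReal_mul (by positivity), ← ENNReal.ofReal_mul (by positivity)]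
        congr 1
        have e1 : ∀ n : ℕ, (2 : ℝ) ^ (a - n) = 2 ^ a * (1 / 2) ^ n := by
          intro n
          rw [zpow_sub₀ two_ne_zero, zpow_natCast, div_eq_mul_inv, one_div, inv_pow]
        have e2 : ∀ k : ℤ, (2 : ℝ) ^ (k + 1) = 2 * 2 ^ k := by
          intro k
          rw [zpow_add₀ two_ne_zero, zpow_one, mul_comm]
        rw [e2, e2, e1, e1]
        have h1 := hz a
        have h2 : (0 : ℝ) < (1 / 2) ^ i := by positivity
        have h3 : (0 : ℝ) < (1 / 2) ^ j := by positivity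
        generalize (2 : ℝ) ^ a = A at *
        generalize ((1 : ℝ) / 2) ^ i = B at *
        generalize ((1 : ℝ) / 2) ^ j = D at *
        field_simp
        ring

lemma sum_bound (y : ℤ → ℝ≥0∞) {r : ℝ≥0∞} (D : ℝ≥0∞) :
    ∑' a : ℤ, ∑' i : ℕ, ∑' j : ℕ, D * (r ^ i * r ^ j) *
      (y a ^ (1 / 2 : ℝ) * (y (a - i) ^ (1 / 2 : ℝ) * y (a - j) ^ (1 / 2 : ℝ))) ≤
    D * ((1 - r)⁻¹ * (1 - r)⁻¹) * ((∑' k, y k) ^ (1 / 2 : ℝ) * ∑' k, y k) := by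
  set Y := ∑' k, y k with hY
  have hsq : ∀ z : ℝ≥0∞, (z ^ (1 / 2 : ℝ)) ^ 2 = z := by
    intro z
    rw [← ENNReal.rpow_natCast, ← ENNReal.rpow_mul]
    norm_num
  have hle : ∀ k, y k ^ (1 / 2 : ℝ) ≤ Y ^ (1 / 2 : ℝ) := fun k =>
    ENNReal.rpow_le_rpow (ENNReal.le_tsum k) (by norm_num)
  have hpair : ∀ i : ℕ, ∑' a : ℤ, y a ^ (1 / 2 : ℝ) * y (a - i) ^ (1 / 2 : ℝ) ≤ Y := by
    intro i
    have h2 : 2 * ∑' a : ℤ, y a ^ (1 / 2 : ℝ) * y (a - i) ^ (1 / 2 : ℝ) ≤ 2 * Y := by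
      rw [← ENNReal.tsum_mul_left]
      calc _ ≤ ∑' a : ℤ, (y a + y (a - i)) := by
            refine ENNReal.tsum_le_tsum fun a => ?_
            refine (two_mul_le_sq_ennreal _ _).trans (le_of_eq ?_)
            rw [hsq, hsq]
        _ = Y + Y := by
            rw [ENNReal.tsum_add]
            congr 1
            exact (Equiv.subRight (i : ℤ)).tsum_eq y
        _ = _ := (two_mul Y).symm
    exact (ENNReal.mul_le_mul_iff_right (by simp) (by simp)).1 h2
  calc _ ≤ ∑' a : ℤ, ∑' i : ℕ, ∑' j : ℕ, D * (r ^ i * r ^ j) *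
      (y a ^ (1 / 2 : ℝ) * (y (a - i) ^ (1 / 2 : ℝ) * Y ^ (1 / 2 : ℝ))) := by
        refine ENNReal.tsum_le_tsum fun a => ENNReal.tsum_le_tsum fun i =>
          ENNReal.tsum_le_tsum fun j => ?_
        gcongr
        exact ENNReal.le_tsum _
    _ = ∑' a : ℤ, ∑' i : ℕ, ∑' j : ℕ, (D * Y ^ (1 / 2 : ℝ) * r ^ i *
          (y a ^ (1 / 2 : ℝ) * y (a - i) ^ (1 / 2 : ℝ))) * r ^ j := by
        refine tsum_congr fun a => tsum_congr fun i => tsum_congr fun j => ?_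
        ring
    _ = ∑' a : ℤ, ∑' i : ℕ, (D * Y ^ (1 / 2 : ℝ) * r ^ i *
          (y a ^ (1 / 2 : ℝ) * y (a - i) ^ (1 / 2 : ℝ))) * (1 - r)⁻¹ := by
        simp_rw [ENNReal.tsum_mul_left, ENNReal.tsum_geometric]
    _ = ∑' i : ℕ, (D * Y ^ (1 / 2 : ℝ) * r ^ i *
          ∑' a : ℤ, (y a ^ (1 / 2 : ℝ) * y (a - i) ^ (1 / 2 : ℝ))) * (1 - r)⁻¹ := by
        rw [ENNReal.tsum_comm]
        simp_rw [ENNReal.tsum_mul_right, ENNReal.tsum_mul_left]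
    _ ≤ ∑' i : ℕ, (D * Y ^ (1 / 2 : ℝ) * r ^ i * Y) * (1 - r)⁻¹ := by
        refine ENNReal.tsum_le_tsum fun i => ?_
        gcongr
        exact hpair i
    _ = _ := by
        simp_rw [ENNReal.tsum_mul_right, ENNReal.tsum_mul_left, ENNReal.tsum_geometric]
        ring

lemma homog_cone {c : ℝ} (hc : 0 < c) : ∃ C : ℝ≥0∞, C ≠ ⊤ ∧ ∀ (P : E3 → ℝ) (S : Set E3)
    (L : E3 ≃ₗᵢ[ℝ] E3), Measurable P → GoodCone P S L c → ∀ h : E3 → ℂ, Measurable h →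
    Integrable h → (∀ ξ, h ξ ≠ 0 → ξ ∈ S) →
    ∫⁻ q : ℝ × E3, ‖ext3 P h q.1 q.2‖ₑ ^ 6 ≤ C * (∫⁻ ξ, ‖ξ‖ₑ ^ 2 * ‖h ξ‖ₑ ^ 2) ^ 3 := by
  set K0 : ℝ := (2 * Real.pi) ^ 3 * (2 * Real.pi * (32 * Real.pi / c ^ 2 * 64)) with hK0
  have hK0p : 0 ≤ K0 := by positivity
  set D : ℝ≥0∞ := ENNReal.ofReal (Real.sqrt K0) with hD
  set r : ℝ≥0∞ := ENNReal.ofReal (Real.sqrt (1 / 2)) with hr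
  have hr1 : r < 1 := by
    rw [hr, ENNReal.ofReal_lt_one]
    rw [Real.sqrt_lt' one_pos]; norm_num
  refine ⟨(3 * (D * ((1 - r)⁻¹ * (1 - r)⁻¹))) ^ 2, ?_, ?_⟩
  · have : (1 - r)⁻¹ ≠ ⊤ := by
      rw [ENNReal.inv_ne_top]
      exact (tsub_pos_of_lt hr1).ne'
    finiteness
  intro P S L hP hG h hm hi hs
  set X := ∫⁻ ξ, ‖ξ‖ₑ ^ 2 * ‖h ξ‖ₑ ^ 2 with hX
  set y : ℤ → ℝ≥0∞ := fun k => ∫⁻ ξ in ann k, ‖ξ‖ₑ ^ 2 * ‖h ξ‖ₑ ^ 2 with hy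
  have hyX : ∑' k, y k ≤ X := by
    rw [hy, ← lintegral_iUnion ann_meas ann_disj]
    exact setLIntegral_le_lintegral _ _
  set V : ℤ → ℝ × E3 → ℂ := fun k q => ext3 P ((ann k).indicator h) q.1 q.2 with hV
  have hVm : ∀ k, Measurable (V k) := fun k => ext3_meas hP (hm.indicator (ann_meas k))
  set F : ℤ × ℕ × ℕ → ℝ × E3 → ℝ≥0∞ := fun z q =>
    ‖V z.1 q * (V (z.1 - z.2.1) q * V (z.1 - z.2.2) q)‖ₑ with hF
  set b : ℤ × ℕ × ℕ → ℝ≥0∞ := fun z => D * (r ^ z.2.1 * r ^ z.2.2) *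
      (y z.1 ^ (1 / 2 : ℝ) * (y (z.1 - z.2.1) ^ (1 / 2 : ℝ) * y (z.1 - z.2.2) ^ (1 / 2 : ℝ))) with hb
  have hsq : ∀ z : ℝ≥0∞, (z ^ (1 / 2 : ℝ)) ^ 2 = z := by
    intro z
    rw [← ENNReal.rpow_natCast, ← ENNReal.rpow_mul]
    norm_num
  have hmk := mink (Measure.count : Measure (ℤ × ℕ × ℕ)) (volume : Measure (ℝ × E3)) (F := F) ?_
    (b := b) (measurable_of_countable b) (p := 2) (by norm_num) ?_
  · have hpt : ∀ q : ℝ × E3, ‖ext3 P h q.1 q.2‖ₑ ^ 6 ≤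
        9 * (∫⁻ z, F z q ∂Measure.count) ^ (2 : ℝ) := by
      intro q
      have h1 : ‖ext3 P h q.1 q.2‖ₑ ^ 3 ≤ 3 * ∫⁻ z, F z q ∂Measure.count := by
        refine (pow_le_pow_left₀ zero_le (ext3_dyadic hP hi q.1 q.2) 3).trans ?_
        refine (cube_tsum_le _).trans (le_of_eq ?_)
        rw [lintegral_count, ENNReal.tsum_prod']
        congr 1
        refine tsum_congr fun a => ?_
        rw [ENNReal.tsum_prod']
        simp only [hF, hV, enorm_mul]
      calc _ = (‖ext3 P h q.1 q.2‖ₑ ^ 3) ^ 2 := by ring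
        _ ≤ (3 * ∫⁻ z, F z q ∂Measure.count) ^ 2 := by gcongr
        _ = _ := by rw [ENNReal.rpow_two]; ring
    calc _ ≤ ∫⁻ q, 9 * (∫⁻ z, F z q ∂Measure.count) ^ (2 : ℝ) := lintegral_mono hpt
      _ ≤ 9 * (∫⁻ z, b z ∂Measure.count) ^ (2 : ℝ) := by
        rw [lintegral_const_mul' _ _ (by simp)]
        gcongr
      _ ≤ 9 * (D * ((1 - r)⁻¹ * (1 - r)⁻¹) * (X ^ (1 / 2 : ℝ) * X)) ^ (2 : ℝ) := by
        gcongr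
        rw [lintegral_count, ENNReal.tsum_prod']
        calc _ = ∑' a : ℤ, ∑' i : ℕ, ∑' j : ℕ, D * (r ^ i * r ^ j) *
            (y a ^ (1 / 2 : ℝ) * (y (a - i) ^ (1 / 2 : ℝ) * y (a - j) ^ (1 / 2 : ℝ))) := by
              refine tsum_congr fun a => ?_
              rw [ENNReal.tsum_prod']
          _ ≤ _ := sum_bound y D
          _ ≤ _ := by gcongr
      _ = _ := by
        rw [ENNReal.rpow_two, mul_pow, mul_pow _ X, hsq]
        ring
  · refine measurable_from_prod_countable_right (f := Function.uncurry F) fun z => ?_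
    have : Measurable (fun q => ‖V z.1 q * (V (z.1 - z.2.1) q * V (z.1 - z.2.2) q)‖ₑ) :=
      ((hVm _).mul ((hVm _).mul (hVm _))).enorm
    exact this
  · rintro ⟨a, i, j⟩
    have := triple_bound hP hc hG hm hi hs a i j
    rw [← hK0] at this
    simp_rw [ENNReal.rpow_two]
    refine this.trans (le_of_eq ?_)
    simp only [hb, mul_pow, hsq]
    congr 1
    rw [ENNReal.ofReal_mul hK0p, ENNReal.ofReal_mul (p := (1 / 2) ^ i) (by positivity)]
    congr 1
    · rw [hD, ← ENNReal.ofReal_pow (Real.sqrt_nonneg _), Real.sq_sqrt hK0p]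
    · have e : ∀ n : ℕ, ENNReal.ofReal ((1 / 2) ^ n) = (r ^ n) ^ 2 := by
        intro n
        rw [hr, ← pow_mul, mul_comm, pow_mul, ← ENNReal.ofReal_pow (Real.sqrt_nonneg _),
          Real.sq_sqrt (by norm_num), ENNReal.ofReal_pow (by norm_num)]
      rw [e, e]



lemma sc_of_deriv2 {q q' q'' : ℝ → ℝ} {s s' κ : ℝ}
    (h1 : ∀ x ∈ segment ℝ s s', HasDerivAt q (q' x) x)
    (h2 : ∀ x ∈ segment ℝ s s', HasDerivAt q' (q'' x) x)
    (h3 : ∀ x ∈ segment ℝ s s', κ ≤ q'' x) {θ : ℝ} (hθ0 : 0 ≤ θ) (hθ1 : θ ≤ 1) :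
    q ((1 - θ) * s + θ * s') ≤ (1 - θ) * q s + θ * q s' - θ * (1 - θ) * (κ * (s' - s) ^ 2) / 2 := by
  have hconv : ConvexOn ℝ (segment ℝ s s') (fun x => q x - κ / 2 * x ^ 2) := by
    apply convexOn_of_hasDerivWithinAt2_nonneg (convex_segment s s')
      (f' := fun x => q' x - κ * x) (f'' := fun x => q'' x - κ)
    · intro x hx
      exact ((h1 x hx).continuousAt.sub (by fun_prop)).continuousWithinAt
    · intro x hx
      have := (h1 x (interior_subset hx)).sub (((hasDerivAt_id x).pow 2).const_mul (κ / 2))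
      apply HasDerivAt.hasDerivWithinAt
      convert! this using 1
      simp; ring
    · intro x hx
      have := (h2 x (interior_subset hx)).sub ((hasDerivAt_id x).const_mul κ)
      apply HasDerivAt.hasDerivWithinAt
      convert! this using 1
      simp
    · intro x hx
      have := h3 x (interior_subset hx)
      linarith
  have := hconv.2 (left_mem_segment ℝ s s') (right_mem_segment ℝ s s') (sub_nonneg.2 hθ1) hθ0
    (by ring)
  simp only [smul_eq_mul] at this
  nlinarith [this]

lemma deriv_r {w x : ℝ} (h : 0 < x ^ 2 + w) :
    HasDerivAt (fun x => Real.sqrt (x ^ 2 + w)) (x / Real.sqrt (x ^ 2 + w)) x := by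
  have h1 : HasDerivAt (fun x : ℝ => x ^ 2 + w) (2 * x) x := by
    have := ((hasDerivAt_id x).pow 2).add_const w
    simpa using this
  convert! h1.sqrt h.ne' using 1
  rw [mul_div_mul_left _ _ two_ne_zero]

lemma coneB_deriv {y z x : ℝ} (hr : 0 < x ^ 2 + y ^ 2) (hρ : 0 < x ^ 2 + (y ^ 2 + z ^ 2)) :
    HasDerivAt (fun x => Real.sqrt (x ^ 2 + y ^ 2) / Real.sqrt (x ^ 2 + (y ^ 2 + z ^ 2)))
      (z ^ 2 * x / (Real.sqrt (x ^ 2 + y ^ 2) * Real.sqrt (x ^ 2 + (y ^ 2 + z ^ 2)) ^ 3)) x := by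
  have h1 := (deriv_r hr).div (deriv_r hρ) (Real.sqrt_pos.2 hρ).ne'
  convert! h1 using 1
  have e1 := Real.sq_sqrt hr.le
  have e2 := Real.sq_sqrt hρ.le
  have p1 := Real.sqrt_pos.2 hr
  have p2 := Real.sqrt_pos.2 hρ
  generalize Real.sqrt (x ^ 2 + y ^ 2) = r at *
  generalize Real.sqrt (x ^ 2 + (y ^ 2 + z ^ 2)) = ρ at *
  field_simp
  rw [e1, e2]; ring

lemma coneB_deriv2 {y z x : ℝ} (hr : 0 < x ^ 2 + y ^ 2) (hρ : 0 < x ^ 2 + (y ^ 2 + z ^ 2)) :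
    HasDerivAt (fun x => z ^ 2 * x / (Real.sqrt (x ^ 2 + y ^ 2) *
      Real.sqrt (x ^ 2 + (y ^ 2 + z ^ 2)) ^ 3))
      (z ^ 2 * ((x ^ 2 + (y ^ 2 + z ^ 2)) * y ^ 2 - 3 * (x ^ 2 + y ^ 2) * x ^ 2) /
        (Real.sqrt (x ^ 2 + y ^ 2) ^ 3 * Real.sqrt (x ^ 2 + (y ^ 2 + z ^ 2)) ^ 5)) x := by
  have p1 := Real.sqrt_pos.2 hr
  have p2 := Real.sqrt_pos.2 hρ
  have h1 := ((hasDerivAt_id x).const_mul (z ^ 2)).div ((deriv_r hr).mul ((deriv_r hρ).pow 3))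
    (by simp only [Pi.mul_apply, Pi.pow_apply]; positivity)
  convert! h1 using 1
  simp only [Pi.mul_apply, Pi.pow_apply, id]
  have e1 := Real.sq_sqrt hr.le
  have e2 := Real.sq_sqrt hρ.le
  generalize Real.sqrt (x ^ 2 + y ^ 2) = r at *
  generalize Real.sqrt (x ^ 2 + (y ^ 2 + z ^ 2)) = ρ at *
  rw [← e1, ← e2, show y ^ 2 = r ^ 2 - x ^ 2 by linarith]
  field_simp
  push_cast
  ring

lemma coneB_lower {y z x R : ℝ} (hr : 0 < x ^ 2 + y ^ 2) (hρ : 0 < x ^ 2 + (y ^ 2 + z ^ 2))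
    (hR : 0 < R) (hρR : Real.sqrt (x ^ 2 + (y ^ 2 + z ^ 2)) ≤ R) (h1 : 3 * x ^ 2 ≤ y ^ 2)
    (h2 : x ^ 2 + y ^ 2 ≤ 4 * z ^ 2) :
    (1 / 10 / R) ^ 2 ≤ z ^ 2 * ((x ^ 2 + (y ^ 2 + z ^ 2)) * y ^ 2 - 3 * (x ^ 2 + y ^ 2) * x ^ 2) /
        (Real.sqrt (x ^ 2 + y ^ 2) ^ 3 * Real.sqrt (x ^ 2 + (y ^ 2 + z ^ 2)) ^ 5) := by
  have p1 := Real.sqrt_pos.2 hr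
  have p2 := Real.sqrt_pos.2 hρ
  have e1 := Real.sq_sqrt hr.le
  have e2 := Real.sq_sqrt hρ.le
  have hle : Real.sqrt (x ^ 2 + y ^ 2) ≤ Real.sqrt (x ^ 2 + (y ^ 2 + z ^ 2)) :=
    Real.sqrt_le_sqrt (by nlinarith [sq_nonneg z])
  have key : (x ^ 2 + y ^ 2) * (x ^ 2 + (y ^ 2 + z ^ 2)) ^ 2 ≤
      100 * (z ^ 2 * ((x ^ 2 + (y ^ 2 + z ^ 2)) * y ^ 2 - 3 * (x ^ 2 + y ^ 2) * x ^ 2)) := by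
    have ha := sq_nonneg x
    have hb := sq_nonneg y
    have hw := sq_nonneg z
    generalize x ^ 2 = a at *
    generalize y ^ 2 = b at *
    generalize z ^ 2 = w at *
    have k1 : 3 / 4 * w * (a + b) ≤ (a + (b + w)) * b - 3 * (a + b) * a := by nlinarith
    have k2 : (a + (b + w)) ^ 2 ≤ 25 * w ^ 2 := by nlinarith
    calc _ ≤ (a + b) * (25 * w ^ 2) := by gcongr
      _ ≤ 100 * (w * (3 / 4 * w * (a + b))) := by nlinarith [mul_nonneg hr.le (sq_nonneg w)]
      _ ≤ _ := by gcongr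
  generalize Real.sqrt (x ^ 2 + y ^ 2) = r at *
  generalize Real.sqrt (x ^ 2 + (y ^ 2 + z ^ 2)) = ρ at *
  generalize z ^ 2 * ((x ^ 2 + (y ^ 2 + z ^ 2)) * y ^ 2 - 3 * (x ^ 2 + y ^ 2) * x ^ 2) = K at *
  rw [← e1, ← e2] at key
  rw [le_div_iff₀ (by positivity), div_pow, div_mul_eq_mul_div, div_le_iff₀ (by positivity)]
  have hK : 0 ≤ K := by nlinarith [sq_nonneg (r * ρ ^ 2)]
  have hρR2 : ρ ^ 2 ≤ R ^ 2 := by gcongr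
  have h5 : r ^ 3 * ρ ^ 5 ≤ r ^ 2 * (ρ ^ 2) ^ 2 * ρ ^ 2 := by
    calc r ^ 3 * ρ ^ 5 = r ^ 2 * ρ ^ 5 * r := by ring
      _ ≤ r ^ 2 * ρ ^ 5 * ρ := by gcongr
      _ = _ := by ring
  have h6 : r ^ 2 * (ρ ^ 2) ^ 2 * ρ ^ 2 ≤ 100 * K * R ^ 2 := by gcongr
  linarith

lemma coneA_deriv {r x : ℝ} (hρ : 0 < x ^ 2 + r ^ 2) :
    HasDerivAt (fun x => -(r / Real.sqrt (x ^ 2 + r ^ 2)))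
      (r * x / Real.sqrt (x ^ 2 + r ^ 2) ^ 3) x := by
  have p2 := Real.sqrt_pos.2 hρ
  have h1 := (((hasDerivAt_const x r)).div (deriv_r hρ) p2.ne').neg
  convert! h1 using 1
  generalize Real.sqrt (x ^ 2 + r ^ 2) = ρ at *
  field_simp
  ring

lemma coneA_deriv2 {r x : ℝ} (hρ : 0 < x ^ 2 + r ^ 2) :
    HasDerivAt (fun x => r * x / Real.sqrt (x ^ 2 + r ^ 2) ^ 3)
      (r * (r ^ 2 - 2 * x ^ 2) / Real.sqrt (x ^ 2 + r ^ 2) ^ 5) x := by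
  have p2 := Real.sqrt_pos.2 hρ
  have h1 := ((hasDerivAt_id x).const_mul r).div ((deriv_r hρ).pow 3)
    (by simp only [Pi.pow_apply]; positivity)
  convert! h1 using 1
  simp only [Pi.pow_apply, id]
  have e2 := Real.sq_sqrt hρ.le
  generalize Real.sqrt (x ^ 2 + r ^ 2) = ρ at *
  rw [show r ^ 2 = ρ ^ 2 - x ^ 2 by linarith]
  field_simp
  push_cast
  ring

lemma coneA_lower {r x R : ℝ} (hr : 0 < r)
    (hR : 0 < R) (hρR : Real.sqrt (x ^ 2 + r ^ 2) ≤ R) (h1 : 4 * x ^ 2 ≤ r ^ 2) :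
    (1 / 10 / R) ^ 2 ≤ r * (r ^ 2 - 2 * x ^ 2) / Real.sqrt (x ^ 2 + r ^ 2) ^ 5 := by
  have hρ : 0 < x ^ 2 + r ^ 2 := by positivity
  have p2 := Real.sqrt_pos.2 hρ
  have h2 : Real.sqrt (x ^ 2 + r ^ 2) ≤ 2 * r := by
    rw [Real.sqrt_le_left (by positivity)]; nlinarith
  generalize Real.sqrt (x ^ 2 + r ^ 2) = ρ at *
  rw [le_div_iff₀ (by positivity), div_pow, div_mul_eq_mul_div, div_le_iff₀ (by positivity)]
  have hρR2 : ρ ^ 2 ≤ R ^ 2 := by gcongr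
  have h3 : ρ ^ 3 ≤ (2 * r) ^ 3 := by gcongr
  have h4 : r * (r ^ 2 / 2) ≤ r * (r ^ 2 - 2 * x ^ 2) := by gcongr; linarith
  have hK : 0 ≤ r * (r ^ 2 - 2 * x ^ 2) := le_trans (by positivity) h4
  have h5 : ρ ^ 3 ≤ 100 * (r * (r ^ 2 - 2 * x ^ 2)) := by nlinarith [pow_pos hr 3]
  calc _ = (1 / 10) ^ 2 * (ρ ^ 3 * ρ ^ 2) := by ring
    _ ≤ (1 / 10) ^ 2 * ((100 * (r * (r ^ 2 - 2 * x ^ 2))) * R ^ 2) := by gcongr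
    _ = _ := by ring



lemma goodCone_mk {P : E3 → ℝ} {S : Set E3} {L : E3 ≃ₗᵢ[ℝ] E3} (hcl : IsClosed S)
    (hseg : ∀ y s s', L (vec3 (s, y)) ∈ S → L (vec3 (s', y)) ∈ S → ∀ x ∈ segment ℝ s s',
      L (vec3 (x, y)) ∈ S)
    (hD : ∀ y, {s | L (vec3 (s, y)) ∈ S}.Subsingleton ∨ ∃ q q' q'' : ℝ → ℝ,
      (∀ s, P (L (vec3 (s, y))) = q s) ∧ ∀ x, L (vec3 (x, y)) ∈ S →
        HasDerivAt q (q' x) x ∧ HasDerivAt q' (q'' x) x ∧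
        ∀ R, 0 < R → ‖L (vec3 (x, y))‖ ≤ R → (1 / 10 / R) ^ 2 ≤ q'' x) :
    GoodCone P S L (1 / 10) where
  closed := hcl
  cont := by
    intro y
    rcases hD y with h | ⟨q, q', q'', hq, h⟩
    · exact h.continuousOn _
    · simp only [hq]
      intro x hx
      exact (h x hx).1.continuousAt.continuousWithinAt
  sc := by
    intro R hR y s s' hs hs' hn hn' θ h0 h1
    have hmem : (1 - θ) * s + θ * s' ∈ segment ℝ s s' :=
      ⟨1 - θ, θ, sub_nonneg.2 h1, h0, by ring, by simp⟩
    refine ⟨hseg y s s' hs hs' _ hmem, ?_⟩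
    rcases hD y with h | ⟨q, q', q'', hq, h⟩
    · obtain rfl : s = s' := h hs hs'
      rw [show (1 - θ) * s + θ * s = s by ring]
      apply le_of_eq; ring
    · have hb : ∀ x ∈ segment ℝ s s', ‖L (vec3 (x, y))‖ ≤ R := by
        rintro x ⟨a, b, ha, hb, hab, rfl⟩
        have : vec3 (a • s + b • s', y) = a • vec3 (s, y) + b • vec3 (s', y) := by
          ext i
          fin_cases i
          · simp [vec3]
          · simp [vec3, ← add_mul, hab]
          · simp [vec3, ← add_mul, hab]
        rw [this, map_add, map_smul, map_smul]
        calc _ ≤ a * R + b * R := by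
              refine (norm_add_le _ _).trans ?_
              rw [norm_smul, norm_smul, Real.norm_of_nonneg ha, Real.norm_of_nonneg hb]
              gcongr
          _ = R := by rw [← add_mul, hab, one_mul]
      have := sc_of_deriv2 (q := q) (q' := q') (q'' := q'') (s := s) (s' := s')
        (κ := (1 / 10 / R) ^ 2) (θ := θ)
        (fun x hx => (h x (hseg y s s' hs hs' x hx)).1)
        (fun x hx => (h x (hseg y s s' hs hs' x hx)).2.1)
        (fun x hx => (h x (hseg y s s' hs hs' x hx)).2.2 R hR (hb x hx)) h0 h1
      rw [hq, hq, hq]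
      refine this.trans (le_of_eq ?_)
      field_simp

lemma norm_e3 (v : E3) : ‖v‖ = Real.sqrt (v 0 ^ 2 + v 1 ^ 2 + v 2 ^ 2) := by
  rw [EuclideanSpace.norm_eq, Fin.sum_univ_three]; simp

/-- Horizontal rotation. -/
def rotL (c s : ℝ) (h : c ^ 2 + s ^ 2 = 1) : E3 ≃ₗᵢ[ℝ] E3 :=
  LinearIsometry.toLinearIsometryEquiv
    { toFun := fun v => !₂[c * v 0 - s * v 1, s * v 0 + c * v 1, v 2]
      map_add' := by intro v w; ext i; fin_cases i <;> simp <;> ring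
      map_smul' := by intro a w; ext i; fin_cases i <;> simp <;> ring
      norm_map' := by
        intro v
        rw [norm_e3, norm_e3]
        congr 1
        simp
        linear_combination (v 0 ^ 2 + v 1 ^ 2) * h } rfl

lemma rotL_apply (c s : ℝ) (h : c ^ 2 + s ^ 2 = 1) (v : E3) :
    rotL c s h v = !₂[c * v 0 - s * v 1, s * v 0 + c * v 1, v 2] := rfl

/-- Cyclic permutation of coordinates. -/
def permL : E3 ≃ₗᵢ[ℝ] E3 :=
  LinearIsometry.toLinearIsometryEquiv
    { toFun := fun v => !₂[v 1, v 2, v 0]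
      map_add' := by intro v w; ext i; fin_cases i <;> simp
      map_smul' := by intro a w; ext i; fin_cases i <;> simp
      norm_map' := by
        intro v
        rw [norm_e3, norm_e3]
        congr 1
        simp
        ring } rfl

lemma permL_apply (v : E3) : permL v = !₂[v 1, v 2, v 0] := rfl

def coneA : Set E3 := {ξ | 4 * (ξ 2) ^ 2 ≤ (ξ 0) ^ 2 + (ξ 1) ^ 2}

def coneB (c s : ℝ) : Set E3 := {ξ | (ξ 0) ^ 2 + (ξ 1) ^ 2 ≤ 4 * (ξ 2) ^ 2 ∧
  3 * (c * ξ 0 + s * ξ 1) ^ 2 ≤ (-s * ξ 0 + c * ξ 1) ^ 2}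

lemma sq_seg {s s' w x : ℝ} (h1 : s ^ 2 ≤ w) (h2 : s' ^ 2 ≤ w) (hx : x ∈ segment ℝ s s') :
    x ^ 2 ≤ w := by
  obtain ⟨a, b, ha, hb, hab, rfl⟩ := hx
  simp only [smul_eq_mul]
  have : a = 1 - b := by linarith
  subst this
  nlinarith [mul_nonneg (mul_nonneg ha hb) (sq_nonneg (s - s'))]

lemma coneA_good : GoodCone (fun ξ => -pStrat ξ) coneA permL (1 / 10) := by
  have hmem : ∀ s y, permL (vec3 (s, y)) ∈ coneA ↔ 4 * s ^ 2 ≤ y.1 ^ 2 + y.2 ^ 2 := by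
    intro s y
    simp [coneA, permL_apply, vec3]
  apply goodCone_mk
  · apply isClosed_le <;> fun_prop
  · intro y s s' hs hs' x hx
    rw [hmem] at *
    have := sq_seg (w := (y.1 ^ 2 + y.2 ^ 2) / 4) (by linarith) (by linarith) hx
    linarith
  · intro y
    have hw : 0 ≤ y.1 ^ 2 + y.2 ^ 2 := by positivity
    have hr2 := Real.sq_sqrt hw
    rcases hw.eq_or_lt with h0 | h0
    · left
      intro s hs s' hs'
      simp only [Set.mem_ofPred_eq, hmem, ← h0] at hs hs'
      have e1 : s = 0 := by nlinarith
      have e2 : s' = 0 := by nlinarith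
      rw [e1, e2]
    · right
      have hr := Real.sqrt_pos.2 h0
      set r := Real.sqrt (y.1 ^ 2 + y.2 ^ 2) with hrdef
      have hn : ∀ s, ‖permL (vec3 (s, y))‖ = Real.sqrt (s ^ 2 + r ^ 2) := by
        intro s
        rw [permL.norm_map, norm_vec3, hr2]; simp only [add_assoc]
      refine ⟨fun x => -(r / Real.sqrt (x ^ 2 + r ^ 2)), fun x => r * x / Real.sqrt (x ^ 2 + r ^ 2) ^ 3,
        fun x => r * (r ^ 2 - 2 * x ^ 2) / Real.sqrt (x ^ 2 + r ^ 2) ^ 5, ?_, ?_⟩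
      · intro s
        simp only [pStrat, hn]
        simp [permL_apply, vec3, hrdef]
      · intro x hx
        rw [hmem] at hx
        have hp : 0 < x ^ 2 + r ^ 2 := by positivity
        refine ⟨coneA_deriv hp, coneA_deriv2 hp, fun R hR hle => ?_⟩
        rw [hn] at hle
        exact coneA_lower hr hR hle (by linarith)

lemma coneB_good {c s : ℝ} (h : c ^ 2 + s ^ 2 = 1) :
    GoodCone pStrat (coneB c s) (rotL c s h) (1 / 10) := by
  have hmem : ∀ x y, rotL c s h (vec3 (x, y)) ∈ coneB c s ↔
      x ^ 2 + y.1 ^ 2 ≤ 4 * y.2 ^ 2 ∧ 3 * x ^ 2 ≤ y.1 ^ 2 := by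
    intro x y
    simp only [coneB, rotL_apply, vec3, Set.mem_ofPred_eq]
    simp
    rw [show (c * x - s * y.1) ^ 2 + (s * x + c * y.1) ^ 2 = x ^ 2 + y.1 ^ 2 by
        linear_combination (x ^ 2 + y.1 ^ 2) * h,
      show c * (c * x - s * y.1) + s * (s * x + c * y.1) = x by linear_combination x * h,
      show -(s * (c * x - s * y.1)) + c * (s * x + c * y.1) = y.1 by linear_combination y.1 * h]
  apply goodCone_mk
  · exact IsClosed.inter (s₁ := {ξ : E3 | (ξ 0) ^ 2 + (ξ 1) ^ 2 ≤ 4 * (ξ 2) ^ 2})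
      (s₂ := {ξ : E3 | 3 * (c * ξ 0 + s * ξ 1) ^ 2 ≤ (-s * ξ 0 + c * ξ 1) ^ 2})
      (isClosed_le (by fun_prop) (by fun_prop)) (isClosed_le (by fun_prop) (by fun_prop))
  · intro y s s' hs hs' x hx
    rw [hmem] at *
    have h1 := sq_seg (w := 4 * y.2 ^ 2 - y.1 ^ 2) (by linarith) (by linarith) hx
    have h2 := sq_seg (w := y.1 ^ 2 / 3) (by linarith) (by linarith) hx
    constructor <;> linarith
  · intro y
    by_cases h0 : y.1 = 0
    · left
      intro s hs s' hs'
      simp only [Set.mem_ofPred_eq, hmem, h0] at hs hs'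
      have e1 : s = 0 := by nlinarith
      have e2 : s' = 0 := by nlinarith
      rw [e1, e2]
    · right
      have hy : 0 < y.1 ^ 2 := by positivity
      have hn : ∀ s', ‖rotL c s h (vec3 (s', y))‖ = Real.sqrt (s' ^ 2 + (y.1 ^ 2 + y.2 ^ 2)) := by
        intro s'
        rw [(rotL c s h).norm_map, norm_vec3]; simp only [add_assoc]
      refine ⟨fun x => Real.sqrt (x ^ 2 + y.1 ^ 2) / Real.sqrt (x ^ 2 + (y.1 ^ 2 + y.2 ^ 2)),
        fun x => y.2 ^ 2 * x / (Real.sqrt (x ^ 2 + y.1 ^ 2) *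
          Real.sqrt (x ^ 2 + (y.1 ^ 2 + y.2 ^ 2)) ^ 3),
        fun x => y.2 ^ 2 * ((x ^ 2 + (y.1 ^ 2 + y.2 ^ 2)) * y.1 ^ 2
          - 3 * (x ^ 2 + y.1 ^ 2) * x ^ 2) /
          (Real.sqrt (x ^ 2 + y.1 ^ 2) ^ 3 * Real.sqrt (x ^ 2 + (y.1 ^ 2 + y.2 ^ 2)) ^ 5),
        ?_, fun x hx => ?_⟩
      · intro x
        simp only [pStrat, hn]
        have : (rotL c s h (vec3 (x, y)) 0) ^ 2 + (rotL c s h (vec3 (x, y)) 1) ^ 2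
            = x ^ 2 + y.1 ^ 2 := by
          simp [rotL_apply, vec3]
          linear_combination (x ^ 2 + y.1 ^ 2) * h
        rw [this]
      · rw [hmem] at hx
        have hr : 0 < x ^ 2 + y.1 ^ 2 := by positivity
        have hp : 0 < x ^ 2 + (y.1 ^ 2 + y.2 ^ 2) := by positivity
        refine ⟨coneB_deriv hr hp, coneB_deriv2 hr hp, fun R hR hle => ?_⟩
        rw [hn] at hle
        exact coneB_lower hr hp hR hle hx.2 hx.1

lemma cones_cover (ξ : E3) : ξ ∈ coneA ∨ ξ ∈ coneB 1 0 ∨ ξ ∈ coneB (1 / 2) (Real.sqrt 3 / 2) ∨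
    ξ ∈ coneB (1 / 2) (-(Real.sqrt 3 / 2)) := by
  simp only [coneA, coneB, Set.mem_ofPred_eq]
  have h3 : Real.sqrt 3 ^ 2 = 3 := Real.sq_sqrt (by norm_num)
  have h3p : 0 < Real.sqrt 3 := by positivity
  generalize Real.sqrt 3 = k at *
  generalize ξ 0 = x
  generalize ξ 1 = y
  generalize ξ 2 = z
  by_contra! hcon
  obtain ⟨h1, h2, h4, h5⟩ := hcon
  have h2 := h2 h1.le
  have h4 := h4 h1.le
  have h5 := h5 h1.le
  have e4 : 3 * (1 / 2 * x + k / 2 * y) ^ 2 - (-(k / 2) * x + 1 / 2 * y) ^ 2 =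
      2 * y * (y + k * x) := by linear_combination (3 / 4 * y ^ 2 - 1 / 4 * x ^ 2) * h3
  have e5 : 3 * (1 / 2 * x + -(k / 2) * y) ^ 2 - (- -(k / 2) * x + 1 / 2 * y) ^ 2 =
      2 * y * (y - k * x) := by linear_combination (3 / 4 * y ^ 2 - 1 / 4 * x ^ 2) * h3
  have f4 : 0 < y * (y + k * x) := by linarith
  have f5 : 0 < y * (y - k * x) := by linarith
  have f := mul_pos f4 f5
  have hy : y ^ 2 < 3 * x ^ 2 := by nlinarith
  have : y * (y + k * x) * (y * (y - k * x)) = y ^ 2 * (y ^ 2 - 3 * x ^ 2) := by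
    linear_combination (-x ^ 2 * y ^ 2) * h3
  nlinarith [sq_nonneg y]

lemma pStrat_meas : Measurable pStrat := by
  unfold pStrat; fun_prop



/-- The homogeneous estimate for data supported in `U`. -/
def Est (P : E3 → ℝ) (U : Set E3) (C : ℝ≥0∞) : Prop :=
  ∀ h : E3 → ℂ, Measurable h → Integrable h → (∀ ξ, h ξ ≠ 0 → ξ ∈ U) →
    ∫⁻ q : ℝ × E3, ‖ext3 P h q.1 q.2‖ₑ ^ 6 ≤ C * (∫⁻ ξ, ‖ξ‖ₑ ^ 2 * ‖h ξ‖ₑ ^ 2) ^ 3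

lemma pow6_add (a b : ℝ≥0∞) : (a + b) ^ 6 ≤ 32 * (a ^ 6 + b ^ 6) := by
  have := ENNReal.rpow_add_le_mul_rpow_add_rpow a b (p := 6) (by norm_num)
  rw [show (6 : ℝ) - 1 = ((5 : ℕ) : ℝ) by norm_num, show (6 : ℝ) = ((6 : ℕ) : ℝ) by norm_num] at this
  simp only [ENNReal.rpow_natCast] at this
  refine this.trans (le_of_eq ?_)
  norm_num

lemma Est.union {P : E3 → ℝ} (hP : Measurable P) {S U : Set E3} {C C' : ℝ≥0∞}
    (h1 : Est P S C) (h2 : Est P U C') (hS : MeasurableSet S) :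
    Est P (S ∪ U) (32 * (C + C')) := by
  intro h hm hi hs
  have m1 := hm.indicator hS
  have m2 := hm.indicator hS.compl
  have i1 := hi.indicator hS
  have i2 := hi.indicator hS.compl
  have b1 := h1 _ m1 i1 (by
    intro ξ hξ
    by_contra hc
    exact hξ (Set.indicator_of_notMem hc _))
  have b2 := h2 _ m2 i2 (by
    intro ξ hξ
    by_cases hc : ξ ∈ S
    · exact absurd (Set.indicator_of_notMem (by simpa using hc) _) hξ
    · rw [Set.indicator_of_mem (by simpa using hc)] at hξ
      exact (hs ξ hξ).resolve_left hc)
  have hadd : ∀ t x, ext3 P h t x = ext3 P (S.indicator h) t x + ext3 P (Sᶜ.indicator h) t x := by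
    intro t x
    unfold ext3
    rw [← integral_add]
    · congr 1; ext ξ
      rw [← mul_add, ← Pi.add_apply (S.indicator h), Set.indicator_self_add_compl]
    · exact integrable_osc i1 (by fun_prop)
    · exact integrable_osc i2 (by fun_prop)
  calc ∫⁻ q : ℝ × E3, ‖ext3 P h q.1 q.2‖ₑ ^ 6
      ≤ ∫⁻ q : ℝ × E3, 32 * (‖ext3 P (S.indicator h) q.1 q.2‖ₑ ^ 6 +
          ‖ext3 P (Sᶜ.indicator h) q.1 q.2‖ₑ ^ 6) := by
        gcongr with q
        rw [hadd]
        exact (pow_le_pow_left' (enorm_add_le _ _) 6).trans (pow6_add _ _)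
    _ = 32 * ((∫⁻ q : ℝ × E3, ‖ext3 P (S.indicator h) q.1 q.2‖ₑ ^ 6) +
          ∫⁻ q : ℝ × E3, ‖ext3 P (Sᶜ.indicator h) q.1 q.2‖ₑ ^ 6) := by
        have := (ext3_meas hP m1).enorm.pow_const 6
        have := (ext3_meas hP m2).enorm.pow_const 6
        rw [lintegral_const_mul' _ _ (by norm_num), lintegral_add_left (by assumption)]
    _ ≤ 32 * (C * (∫⁻ ξ, ‖ξ‖ₑ ^ 2 * ‖h ξ‖ₑ ^ 2) ^ 3 + C' * (∫⁻ ξ, ‖ξ‖ₑ ^ 2 * ‖h ξ‖ₑ ^ 2) ^ 3) := by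
        gcongr
        · exact b1.trans (by gcongr; exact enorm_indicator_le_enorm_self _ _)
        · exact b2.trans (by gcongr; exact enorm_indicator_le_enorm_self _ _)
    _ = _ := by ring

lemma mp_neg_fst : MeasurePreserving (fun q : ℝ × E3 => (-q.1, q.2)) :=
  (Measure.measurePreserving_neg (volume : Measure ℝ)).prod (MeasurePreserving.id volume)

lemma Est.neg {P : E3 → ℝ} (hP : Measurable P) {S : Set E3} {C : ℝ≥0∞}
    (h1 : Est (fun ξ => -P ξ) S C) : Est P S C := by
  intro h hm hi hs
  have := h1 h hm hi hs
  refine le_trans (le_of_eq ?_) this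
  have key := mp_neg_fst.lintegral_comp ((ext3_meas hP hm).enorm.pow_const 6)
  rw [← key]
  congr 1; ext q
  simp [ext3]

lemma homog_pStrat : ∃ C : ℝ≥0∞, C ≠ ⊤ ∧ ∀ h : E3 → ℂ, Measurable h → Integrable h →
    ∫⁻ q : ℝ × E3, ‖ext3 pStrat h q.1 q.2‖ₑ ^ 6 ≤ C * (∫⁻ ξ, ‖ξ‖ₑ ^ 2 * ‖h ξ‖ₑ ^ 2) ^ 3 := by
  obtain ⟨C, hC, hest⟩ := homog_cone (c := 1 / 10) (by norm_num)
  have h3 : Real.sqrt 3 ^ 2 = 3 := Real.sq_sqrt (by norm_num)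
  have gA := coneA_good
  have gB1 := coneB_good (c := 1) (s := 0) (by norm_num)
  have gB2 := coneB_good (c := 1 / 2) (s := Real.sqrt 3 / 2) (by nlinarith)
  have gB3 := coneB_good (c := 1 / 2) (s := -(Real.sqrt 3 / 2))
    (by nlinarith)
  have eA : Est pStrat coneA C := Est.neg pStrat_meas
    (fun h hm hi hs => hest _ _ _ pStrat_meas.neg gA h hm hi hs)
  have eB1 : Est pStrat _ C := fun h hm hi hs => hest _ _ _ pStrat_meas gB1 h hm hi hs
  have eB2 : Est pStrat _ C := fun h hm hi hs => hest _ _ _ pStrat_meas gB2 h hm hi hs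
  have eB3 : Est pStrat _ C := fun h hm hi hs => hest _ _ _ pStrat_meas gB3 h hm hi hs
  have e := eA.union pStrat_meas (eB1.union pStrat_meas (eB2.union pStrat_meas eB3
    gB2.closed.measurableSet) gB1.closed.measurableSet) gA.closed.measurableSet
  refine ⟨_, ?_, fun h hm hi => e h hm hi (fun ξ _ => cones_cover ξ)⟩
  finiteness



lemma fourierTf_eq (g : E3 → ℂ) (ξ : E3) :
    fourierTf g ξ = FourierTransform.fourier g ((2 * Real.pi)⁻¹ • ξ) := by
  rw [Real.fourier_eq', fourierTf]
  congr 1; ext x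
  rw [inner_smul_right, smul_eq_mul]
  congr 2
  have : (2 * Real.pi : ℂ) ≠ 0 := by simp [Real.pi_ne_zero]
  push_cast
  field_simp

lemma slice_deriv (f : SchwartzMap (ℝ × E3) ℂ) (n : ℕ) (t : ℝ) (x : E3) :
    ‖iteratedFDeriv ℝ n (fun x => f (t, x)) x‖ ≤ ‖iteratedFDeriv ℝ n f (t, x)‖ := by
  have e : (fun x => f (t, x)) = (fun q => f (q + (t, 0))) ∘ (ContinuousLinearMap.inr ℝ ℝ E3) := by
    ext x; simp
  have hs : ContDiff ℝ n (fun q => f (q + (t, 0))) :=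
    (f.smooth n).comp (by fun_prop)
  rw [e, ContinuousLinearMap.iteratedFDeriv_comp_right _ hs _ le_rfl, iteratedFDeriv_comp_add_right]
  refine (ContinuousMultilinearMap.norm_compContinuousLinearMap_le _ _).trans ?_
  have : ‖ContinuousLinearMap.inr ℝ ℝ E3‖ ≤ 1 := ContinuousLinearMap.norm_inr_le_one ℝ ℝ E3
  simp only [Finset.prod_const, ContinuousLinearMap.inr_apply, Prod.mk_add_mk, zero_add, add_zero]
  apply mul_le_of_le_one_right (norm_nonneg _)
  exact pow_le_one₀ (norm_nonneg _) this

lemma slice_decay (f : SchwartzMap (ℝ × E3) ℂ) (n : ℕ) : ∃ C, 0 ≤ C ∧ ∀ t x,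
    ‖iteratedFDeriv ℝ n (fun x => f (t, x)) x‖ ≤ C * (1 + |t|) ^ (-4 : ℝ) * (1 + ‖x‖) ^ (-4 : ℝ) := by
  refine ⟨2 ^ 8 * (Finset.Iic (8, n)).sup (fun m => SchwartzMap.seminorm ℝ m.1 m.2) f,
    by positivity, fun t x => ?_⟩
  refine (slice_deriv f n t x).trans ?_
  have := SchwartzMap.one_add_le_sup_seminorm_apply (𝕜 := ℝ) (m := (8, n)) (k := 8) (n := n)
    le_rfl le_rfl f (t, x)
  generalize 2 ^ 8 * (Finset.Iic (8, n)).sup (fun m => SchwartzMap.seminorm ℝ m.1 m.2) f = C at *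
  have h1 : |t| ≤ ‖(t, x)‖ := le_max_left _ _
  have h2 : ‖x‖ ≤ ‖(t, x)‖ := le_max_right _ _
  rw [show (-4 : ℝ) = -((4 : ℕ) : ℝ) by norm_num, Real.rpow_neg (by positivity),
    Real.rpow_neg (by positivity), Real.rpow_natCast, Real.rpow_natCast, mul_assoc, ← mul_inv,
    ← div_eq_mul_inv, le_div_iff₀ (by positivity)]
  calc _ ≤ ‖iteratedFDeriv ℝ n f (t, x)‖ * ((1 + ‖(t, x)‖) ^ 4 * (1 + ‖(t, x)‖) ^ 4) := by gcongr
    _ = (1 + ‖(t, x)‖) ^ 8 * ‖iteratedFDeriv ℝ n f (t, x)‖ := by ring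
    _ ≤ C := this

lemma int_japanese {r : ℝ} (hr : 3 < r) : Integrable (fun x : E3 => (1 + ‖x‖) ^ (-r)) :=
  integrable_one_add_norm (by simpa using hr)

lemma slice_contDiff (f : SchwartzMap (ℝ × E3) ℂ) (t : ℝ) {n : ℕ∞} :
    ContDiff ℝ n (fun x => f (t, x)) :=
  (f.smooth n).comp (by fun_prop)

lemma slice_int (f : SchwartzMap (ℝ × E3) ℂ) (n : ℕ) (t : ℝ) :
    Integrable (fun x => ‖iteratedFDeriv ℝ n (fun x => f (t, x)) x‖) := by
  obtain ⟨C, hC, h⟩ := slice_decay f n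
  refine ((int_japanese (r := 4) (by norm_num)).const_mul (C * (1 + |t|) ^ (-4 : ℝ))).mono'
    ?_ ?_
  · exact ((slice_contDiff f t (n := n)).continuous_iteratedFDeriv le_rfl).norm.aestronglyMeasurable
  · filter_upwards with x
    rw [norm_norm]
    exact h t x

lemma fourier_pow_decay (f : SchwartzMap (ℝ × E3) ℂ) (n : ℕ) : ∃ C, 0 ≤ C ∧ ∀ t ξ,
    ‖ξ‖ ^ n * ‖fourierTf (fun x => f (t, x)) ξ‖ ≤ C * (1 + |t|) ^ (-4 : ℝ) := by
  choose C hC hdec using slice_decay f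
  set J := ∫ x : E3, (1 + ‖x‖) ^ (-4 : ℝ) with hJ
  have hJ0 : 0 ≤ J := integral_nonneg (fun x => by positivity)
  refine ⟨(2 * Real.pi) ^ n * (2 ^ n * ∑ j ∈ Finset.range (n + 1), C j * J), ?_, fun t ξ => ?_⟩
  · have : 0 ≤ ∑ j ∈ Finset.range (n + 1), C j * J :=
      Finset.sum_nonneg (fun j _ => mul_nonneg (hC j) hJ0)
    positivity
  · have key := Real.pow_mul_norm_iteratedFDeriv_fourier_le (K := 0) (N := n)
      (f := fun x => f (t, x)) (slice_contDiff f t)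
      (by
        intro k m hk hm
        have : k = 0 := by simpa using hk
        subst this
        simpa using slice_int f m t) (k := 0) (n := n) le_rfl le_rfl ((2 * Real.pi)⁻¹ • ξ)
    rw [norm_iteratedFDeriv_zero, ← fourierTf_eq, norm_smul, mul_pow, Real.norm_of_nonneg
      (by positivity), inv_pow, mul_assoc, inv_mul_le_iff₀ (by positivity)] at key
    refine key.trans ?_
    rw [mul_assoc ((2 * Real.pi) ^ n)]
    refine mul_le_mul_of_nonneg_left ?_ (by positivity)
    rw [pow_zero, one_mul]
    simp only [Nat.cast_zero, mul_zero, zero_add, mul_assoc]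
    refine mul_le_mul_of_nonneg_left ?_ (by positivity)
    simp only [Finset.range_one, Finset.singleton_product, Finset.sum_map]
    simp only [Function.Embedding.coeFn_mk, pow_zero, one_mul]
    rw [Finset.sum_mul]
    gcongr with j hj
    calc ∫ x, ‖iteratedFDeriv ℝ j (fun x => f (t, x)) x‖
        ≤ ∫ x : E3, C j * (1 + |t|) ^ (-4 : ℝ) * (1 + ‖x‖) ^ (-4 : ℝ) :=
          integral_mono (slice_int f j t) ((int_japanese (by norm_num)).const_mul _)
            (fun x => hdec j t x)
      _ = _ := by rw [integral_const_mul, ← hJ]; ring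

lemma fourier_decay (f : SchwartzMap (ℝ × E3) ℂ) : ∃ C, 0 ≤ C ∧ ∀ t ξ,
    ‖fourierTf (fun x => f (t, x)) ξ‖ ≤ C * (1 + |t|) ^ (-4 : ℝ) * (1 + ‖ξ‖) ^ (-5 : ℝ) := by
  obtain ⟨C0, h0, d0⟩ := fourier_pow_decay f 0
  obtain ⟨C5, h5, d5⟩ := fourier_pow_decay f 5
  refine ⟨32 * (C0 + C5), by positivity, fun t ξ => ?_⟩
  have hξ : (1 + ‖ξ‖) ^ (-5 : ℝ) = ((1 + ‖ξ‖) ^ 5)⁻¹ := by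
    rw [show (-5 : ℝ) = -((5 : ℕ) : ℝ) by norm_num, Real.rpow_neg (by positivity),
      Real.rpow_natCast]
  rw [hξ, ← div_eq_mul_inv, le_div_iff₀ (by positivity)]
  have a0 := d0 t ξ
  have a5 := d5 t ξ
  rw [pow_zero, one_mul] at a0
  have hp : (1 + ‖ξ‖) ^ 5 ≤ 32 * (1 + ‖ξ‖ ^ 5) := by
    rcases le_total ‖ξ‖ 1 with h | h
    · calc (1 + ‖ξ‖) ^ 5 ≤ (1 + 1) ^ 5 := by gcongr
        _ ≤ _ := by nlinarith [pow_nonneg (norm_nonneg ξ) 5]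
    · calc (1 + ‖ξ‖) ^ 5 ≤ (‖ξ‖ + ‖ξ‖) ^ 5 := by gcongr
        _ = 32 * ‖ξ‖ ^ 5 := by ring
        _ ≤ _ := by linarith
  calc _ ≤ ‖fourierTf (fun x => f (t, x)) ξ‖ * (32 * (1 + ‖ξ‖ ^ 5)) := by gcongr
    _ = 32 * (‖fourierTf (fun x => f (t, x)) ξ‖ + ‖ξ‖ ^ 5 * ‖fourierTf (fun x => f (t, x)) ξ‖) := by
      ring
    _ ≤ 32 * (C0 * (1 + |t|) ^ (-4 : ℝ) + C5 * (1 + |t|) ^ (-4 : ℝ)) := by gcongr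
    _ = _ := by ring

lemma fourierTf_meas (f : SchwartzMap (ℝ × E3) ℂ) :
    Measurable (fun q : ℝ × E3 => fourierTf (fun x => f (q.1, x)) q.2) := by
  unfold fourierTf
  have hc : Continuous (fun z : (ℝ × E3) × E3 =>
      Complex.exp (-Complex.I * Complex.ofReal ⟪z.2, z.1.2⟫) * f (z.1.1, z.2)) := by
    have := f.continuous
    fun_prop
  exact (hc.stronglyMeasurable.integral_prod_right' (ν := volume)).measurable

lemma fourierTf_int (f : SchwartzMap (ℝ × E3) ℂ) (t : ℝ) :
    Integrable (fun ξ => fourierTf (fun x => f (t, x)) ξ) := by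
  obtain ⟨C, hC, h⟩ := fourier_decay f
  refine ((int_japanese (r := 5) (by norm_num)).const_mul (C * (1 + |t|) ^ (-4 : ℝ))).mono' ?_ ?_
  · exact ((fourierTf_meas f).comp (by fun_prop : Measurable (fun ξ : E3 => (t, ξ)))).aestronglyMeasurable
  · filter_upwards with ξ using h t ξ

lemma sob_bound (f : SchwartzMap (ℝ × E3) ℂ) : ∃ C, 0 ≤ C ∧ ∀ t (ξ : E3),
    ‖ξ‖ ^ (2 * (1 : ℝ)) * ‖fourierTf (fun x => f (t, x)) ξ‖ ^ 2 ≤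
      C * (1 + |t|) ^ (-8 : ℝ) * (1 + ‖ξ‖) ^ (-8 : ℝ) := by
  obtain ⟨C, hC, h⟩ := fourier_decay f
  refine ⟨C ^ 2, by positivity, fun t ξ => ?_⟩
  have e1 : ‖ξ‖ ^ (2 * (1 : ℝ)) ≤ (1 + ‖ξ‖) ^ (2 : ℝ) := by
    rw [mul_one]
    exact Real.rpow_le_rpow (norm_nonneg _) (by linarith) (by norm_num)
  calc _ ≤ (1 + ‖ξ‖) ^ (2 : ℝ) * (C * (1 + |t|) ^ (-4 : ℝ) * (1 + ‖ξ‖) ^ (-5 : ℝ)) ^ 2 := by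
        gcongr; exact h t ξ
    _ = C ^ 2 * ((1 + |t|) ^ (-4 : ℝ)) ^ 2 * ((1 + ‖ξ‖) ^ (2 : ℝ) * ((1 + ‖ξ‖) ^ (-5 : ℝ)) ^ 2) := by
        ring
    _ = _ := by
        rw [← Real.rpow_mul_natCast (by positivity), ← Real.rpow_mul_natCast (by positivity),
          ← Real.rpow_add (by positivity)]
        norm_num

lemma sob_meas2 (f : SchwartzMap (ℝ × E3) ℂ) : Measurable (fun q : ℝ × E3 =>
    ‖q.2‖ ^ (2 * (1 : ℝ)) * ‖fourierTf (fun x => f (q.1, x)) q.2‖ ^ 2) := by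
  have hm := fourierTf_meas f
  have h1 : Measurable (fun q : ℝ × E3 => ‖q.2‖ ^ (2 * (1 : ℝ))) := by fun_prop
  have h2 : Measurable (fun q : ℝ × E3 => ‖fourierTf (fun x => f (q.1, x)) q.2‖ ^ 2) := by fun_prop
  exact h1.mul h2

lemma sob_meas1 (f : SchwartzMap (ℝ × E3) ℂ) (t : ℝ) : Measurable
    (fun ξ : E3 => ‖ξ‖ ^ (2 * (1 : ℝ)) * ‖fourierTf (fun x => f (t, x)) ξ‖ ^ 2) := by
  have h := sob_meas2 f
  generalize hG : (fun q : ℝ × E3 =>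
    ‖q.2‖ ^ (2 * (1 : ℝ)) * ‖fourierTf (fun x => f (q.1, x)) q.2‖ ^ 2) = G at h
  have hG' : (fun ξ : E3 => ‖ξ‖ ^ (2 * (1 : ℝ)) * ‖fourierTf (fun x => f (t, x)) ξ‖ ^ 2) =
    fun ξ => G (t, ξ) := by
    rw [← hG]
  rw [hG']
  exact h.comp (by fun_prop)

lemma sob_int (f : SchwartzMap (ℝ × E3) ℂ) (t : ℝ) :
    Integrable (fun ξ : E3 => ‖ξ‖ ^ (2 * (1 : ℝ)) * ‖fourierTf (fun x => f (t, x)) ξ‖ ^ 2) := by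
  obtain ⟨C, hC, h⟩ := sob_bound f
  have hi := ((int_japanese (r := 8) (by norm_num)).const_mul (C * (1 + |t|) ^ (-8 : ℝ)))
  refine Integrable.mono' hi (sob_meas1 f t).aestronglyMeasurable
    (Filter.Eventually.of_forall fun ξ => ?_)
  have h1 := h t ξ
  have h0 : 0 ≤ ‖ξ‖ ^ (2 * (1 : ℝ)) * ‖fourierTf (fun x => f (t, x)) ξ‖ ^ 2 := by positivity
  rw [← Real.norm_of_nonneg h0] at h1
  exact h1

lemma sobolev_meas (f : SchwartzMap (ℝ × E3) ℂ) :
    Measurable (fun t : ℝ => sobolevNorm 1 (fun x => f (t, x))) := by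
  unfold sobolevNorm
  exact ((sob_meas2 f).stronglyMeasurable.integral_prod_right' (ν := volume)).measurable.pow_const _

lemma sobolev_int (f : SchwartzMap (ℝ × E3) ℂ) :
    Integrable (fun t : ℝ => sobolevNorm 1 (fun x => f (t, x))) := by
  obtain ⟨C, hC, h⟩ := sob_bound f
  set J := ∫ x : E3, (1 + ‖x‖) ^ (-8 : ℝ) with hJ
  have hJ0 : 0 ≤ J := integral_nonneg (fun x => by positivity)
  have i1 : Integrable (fun t : ℝ => (1 + ‖t‖) ^ (-4 : ℝ)) :=
    integrable_one_add_norm (by simp)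
  refine (i1.const_mul ((C * J) ^ (1 / 2 : ℝ))).mono' (sobolev_meas f).aestronglyMeasurable ?_
  filter_upwards with t
  have h0 : 0 ≤ ∫ ξ : E3, ‖ξ‖ ^ (2 * (1 : ℝ)) * ‖fourierTf (fun x => f (t, x)) ξ‖ ^ 2 :=
    integral_nonneg (fun x => by positivity)
  unfold sobolevNorm
  rw [Real.norm_of_nonneg (by positivity)]
  have : ∫ ξ : E3, ‖ξ‖ ^ (2 * (1 : ℝ)) * ‖fourierTf (fun x => f (t, x)) ξ‖ ^ 2 ≤
      C * J * (1 + ‖t‖) ^ (-8 : ℝ) := by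
    refine (integral_mono (sob_int f t) ((int_japanese (r := 8) (by norm_num)).const_mul _)
      (fun ξ => h t ξ)).trans (le_of_eq ?_)
    rw [integral_const_mul, ← hJ, Real.norm_eq_abs]; ring
  calc _ ≤ (C * J * (1 + ‖t‖) ^ (-8 : ℝ)) ^ (1 / 2 : ℝ) := by gcongr
    _ = _ := by
      rw [Real.mul_rpow (by positivity) (by positivity), ← Real.rpow_mul (by positivity)]
      norm_num



lemma lintegral_rescale {φ : ℝ × E3 → ℝ≥0∞} (hφ : Measurable φ) {a : ℝ} (ha : a ≠ 0) (t' : ℝ) :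
    ∫⁻ q : ℝ × E3, φ (a * (q.1 - t'), q.2) = ENNReal.ofReal |a⁻¹| * ∫⁻ q, φ q := by
  have hm : Measurable (fun q : ℝ × E3 => φ (a * (q.1 - t'), q.2)) := by fun_prop
  rw [Measure.volume_eq_prod, lintegral_prod_symm' _ hm, lintegral_prod_symm' _ hφ,
    ← lintegral_const_mul' _ _ ENNReal.ofReal_ne_top]
  congr 1; ext x
  have hx : Measurable (fun s => φ (s, x)) := by fun_prop
  rw [lintegral_sub_right_eq_self (fun t => φ (a * t, x)) t']
  have := Real.map_volume_mul_left ha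
  calc ∫⁻ t, φ (a * t, x) = ∫⁻ s, φ (s, x) ∂(Measure.map (fun t => a * t) volume) := by
        rw [lintegral_map hx (by fun_prop)]
    _ = _ := by rw [this, lintegral_smul_measure, smul_eq_mul]

lemma ext3_joint_meas {P : E3 → ℝ} (hP : Measurable P) {H : ℝ × E3 → ℂ} (hH : Measurable H)
    (a : ℝ) : Measurable (fun z : ℝ × (ℝ × E3) =>
      ext3 P (fun ξ => H (z.1, ξ)) (a * (z.2.1 - z.1)) z.2.2) := by
  unfold ext3
  have hm : Measurable (fun w : (ℝ × (ℝ × E3)) × E3 =>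
      Complex.exp (Complex.I * ((⟪w.1.2.2, w.2⟫ + (a * (w.1.2.1 - w.1.1)) * P w.2 : ℝ) : ℂ)) *
        H (w.1.1, w.2)) := by fun_prop
  exact (hm.stronglyMeasurable.integral_prod_right' (ν := volume)).measurable

lemma sob_lintegral (f : SchwartzMap (ℝ × E3) ℂ) (t : ℝ) :
    (∫⁻ ξ : E3, ‖ξ‖ₑ ^ 2 * ‖fourierTf (fun x => f (t, x)) ξ‖ₑ ^ 2) ^ (1 / 2 : ℝ) =
      ENNReal.ofReal (sobolevNorm 1 (fun x => f (t, x))) := by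
  unfold sobolevNorm
  rw [← ENNReal.ofReal_rpow_of_nonneg (integral_nonneg (fun x => by positivity)) (by norm_num),
    ofReal_integral_eq_lintegral_ofReal (sob_int f t) (Filter.Eventually.of_forall
      (fun x => by positivity))]
  congr 1
  congr 1; ext ξ
  rw [mul_one, show (2 : ℝ) = ((2 : ℕ) : ℝ) by norm_num, Real.rpow_natCast,
    ENNReal.ofReal_mul (by positivity), ENNReal.ofReal_pow (by positivity),
    ENNReal.ofReal_pow (by positivity), ofReal_norm, ofReal_norm]

lemma inhomog_abs {C : ℝ≥0∞} (hest : ∀ h : E3 → ℂ, Measurable h → Integrable h →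
    ∫⁻ q : ℝ × E3, ‖ext3 pStrat h q.1 q.2‖ₑ ^ 6 ≤ C * (∫⁻ ξ, ‖ξ‖ₑ ^ 2 * ‖h ξ‖ₑ ^ 2) ^ 3)
    {H : ℝ × E3 → ℂ} (hH : Measurable H) (hHi : ∀ t, Integrable (fun ξ => H (t, ξ)))
    {σ : ℝ → ℝ≥0∞} (hσ : Measurable σ)
    (hσe : ∀ t, (∫⁻ ξ : E3, ‖ξ‖ₑ ^ 2 * ‖H (t, ξ)‖ₑ ^ 2) ^ (1 / 2 : ℝ) = σ t)
    {a : ℝ} (ha : a ≠ 0) :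
    ∫⁻ q : ℝ × E3, (∫⁻ t', ‖ext3 pStrat (fun ξ => H (t', ξ))
      (a * (q.1 - t')) q.2‖ₑ) ^ (6 : ℝ) ≤
    ((ENNReal.ofReal |a⁻¹| * C) ^ (1 / 6 : ℝ) * ∫⁻ t', σ t') ^ (6 : ℝ) := by
  rw [← lintegral_const_mul _ hσ]
  have hb : ∀ t' : ℝ, ∫⁻ q : ℝ × E3, ‖ext3 pStrat (fun ξ => H (t', ξ)) (a * (q.1 - t')) q.2‖ₑ ^ (6 : ℝ)
      ≤ ((ENNReal.ofReal |a⁻¹| * C) ^ (1 / 6 : ℝ) * σ t') ^ (6 : ℝ) := by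
    intro t'
    have hm : Measurable (fun ξ => H (t', ξ)) := by fun_prop
    have h1 := hest _ hm (hHi t')
    have h2 := lintegral_rescale ((ext3_meas pStrat_meas hm).enorm.pow_const 6) ha t'
    have e6 : ∀ z : ℝ≥0∞, z ^ (6 : ℝ) = z ^ 6 := fun z => by
      rw [show (6 : ℝ) = ((6 : ℕ) : ℝ) by norm_num, ENNReal.rpow_natCast]
    have e3 : ∀ z : ℝ≥0∞, z ^ (3 : ℝ) = z ^ 3 := fun z => by
      rw [show (3 : ℝ) = ((3 : ℕ) : ℝ) by norm_num, ENNReal.rpow_natCast]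
    refine le_trans (le_of_eq ?_) ((mul_le_mul_right h1 (ENNReal.ofReal |a⁻¹|)).trans (le_of_eq ?_))
    · simp only [e6]
      exact h2
    · rw [← hσe, ENNReal.mul_rpow_of_nonneg _ _ (by norm_num), ← ENNReal.rpow_mul,
        ← ENNReal.rpow_mul, ← mul_assoc, show (1 / 6 * 6 : ℝ) = 1 by norm_num,
        show (1 / 2 * 6 : ℝ) = 3 by norm_num, ENNReal.rpow_one, e3]
  have hm1 := (ext3_joint_meas pStrat_meas hH a).enorm
  have hm2 : Measurable (fun t' => (ENNReal.ofReal |a⁻¹| * C) ^ (1 / 6 : ℝ) * σ t') :=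
    hσ.const_mul _
  generalize hF : (fun (t' : ℝ) (q : ℝ × E3) => ‖ext3 pStrat (fun ξ => H (t', ξ))
      (a * (q.1 - t')) q.2‖ₑ) = F
  have hF' : ∀ t' q, ‖ext3 pStrat (fun ξ => H (t', ξ)) (a * (q.1 - t')) q.2‖ₑ = F t' q := by
    intro t' q; rw [← hF]
  simp only [hF'] at hb hm1 ⊢
  exact mink volume volume (p := 6) hm1 hm2 (by norm_num) hb

lemma inhomog {C : ℝ≥0∞} (hest : ∀ h : E3 → ℂ, Measurable h → Integrable h →
    ∫⁻ q : ℝ × E3, ‖ext3 pStrat h q.1 q.2‖ₑ ^ 6 ≤ C * (∫⁻ ξ, ‖ξ‖ₑ ^ 2 * ‖h ξ‖ₑ ^ 2) ^ 3)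
    (f : SchwartzMap (ℝ × E3) ℂ) {a : ℝ} (ha : a ≠ 0) :
    ∫⁻ q : ℝ × E3, (∫⁻ t', ‖ext3 pStrat (fun ξ => fourierTf (fun x => f (t', x)) ξ)
      (a * (q.1 - t')) q.2‖ₑ) ^ (6 : ℝ) ≤
    ((ENNReal.ofReal |a⁻¹| * C) ^ (1 / 6 : ℝ) *
      ENNReal.ofReal (∫ t', sobolevNorm 1 (fun x => f (t', x)))) ^ (6 : ℝ) := by
  have hs0 : ∀ t', 0 ≤ sobolevNorm 1 (fun x => f (t', x)) := fun t' =>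
    Real.rpow_nonneg (integral_nonneg (fun x => by positivity)) _
  rw [ofReal_integral_eq_lintegral_ofReal (sobolev_int f) (Filter.Eventually.of_forall hs0)]
  exact inhomog_abs hest (fourierTf_meas f) (fourierTf_int f) (sobolev_meas f).ennreal_ofReal
    (sob_lintegral f) ha

lemma final_est : ∃ C : ℝ, 0 < C ∧ ∀ N : ℝ, 0 < N → ∀ sgn : ℝ, (sgn = 1 ∨ sgn = -1) →
      ∀ f : SchwartzMap (ℝ × EuclideanSpace ℝ (Fin 3)) ℂ,
        eLpNorm (fun p : ℝ × EuclideanSpace ℝ (Fin 3) =>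
            ∫ t' in (0 : ℝ)..p.1,
              ∫ ξ : EuclideanSpace ℝ (Fin 3),
                Complex.exp (Complex.I *
                  Complex.ofReal (⟪p.2, ξ⟫ + sgn * (p.1 - t') * N * pStrat ξ)) *
                  fourierTf (fun x => f (t', x)) ξ) 6 volume
          ≤ ENNReal.ofReal (C * N ^ (-(1 / 6) : ℝ) *
              ∫ t' : ℝ, sobolevNorm 1 (fun x => f (t', x))) := by
  obtain ⟨C, hC, hest⟩ := homog_pStrat
  refine ⟨C.toReal ^ (1 / 6 : ℝ) + 1, by positivity, ?_⟩
  intro N hN sgn hsgn f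
  have habs : |sgn| = 1 := by rcases hsgn with h | h <;> simp [h]
  have ha : sgn * N ≠ 0 := by
    rw [← abs_pos, abs_mul, habs, one_mul]; exact abs_pos.2 hN.ne'
  have main := inhomog hest f ha
  rw [one_div] at main
  have hs0 : ∀ t', 0 ≤ sobolevNorm 1 (fun x => f (t', x)) := fun t' =>
    Real.rpow_nonneg (integral_nonneg (fun x => by positivity)) _
  have hI0 : 0 ≤ ∫ t', sobolevNorm 1 (fun x => f (t', x)) := integral_nonneg hs0
  rw [eLpNorm_eq_lintegral_rpow_enorm_toReal (by norm_num) (by norm_num)]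
  have e6 : (6 : ℝ≥0∞).toReal = 6 := by norm_num
  rw [e6, one_div, ENNReal.rpow_inv_le_iff (by norm_num)]
  refine le_trans ?_ (main.trans ?_)
  · gcongr with p
    rw [intervalIntegral.intervalIntegral_eq_integral_uIoc, enorm_smul]
    have e0 : ‖(if (0 : ℝ) ≤ p.1 then 1 else -1 : ℝ)‖ₑ = 1 := by split_ifs <;> simp
    rw [e0, one_mul]
    refine (enorm_integral_le_lintegral_enorm _).trans ((setLIntegral_le_lintegral _ _).trans ?_)
    apply le_of_eq
    congr 1; ext t'
    unfold ext3
    congr 2; ext ξ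
    rw [show sgn * (p.1 - t') * N * pStrat ξ = sgn * N * (p.1 - t') * pStrat ξ by ring]
  · gcongr
    rw [ENNReal.ofReal_mul (by positivity)]
    gcongr
    have e1 : |(sgn * N)⁻¹| = N⁻¹ := by rw [abs_inv, abs_mul, habs, one_mul, abs_of_pos hN]
    rw [e1, ← ENNReal.ofReal_toReal hC, ← ENNReal.ofReal_mul (by positivity),
      ENNReal.ofReal_rpow_of_nonneg (by positivity) (by norm_num)]
    apply ENNReal.ofReal_le_ofReal
    rw [Real.mul_rpow (by positivity) (by positivity), Real.rpow_neg hN.le, Real.inv_rpow hN.le,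
      mul_comm]
    rw [ENNReal.toReal_ofReal (by positivity)]
    gcongr
    linarith


theorem strichartz_boussinesq_inhomogeneous :
    ∃ C : ℝ, 0 < C ∧ ∀ N : ℝ, 0 < N → ∀ sgn : ℝ, (sgn = 1 ∨ sgn = -1) →
      ∀ f : SchwartzMap (ℝ × EuclideanSpace ℝ (Fin 3)) ℂ,
        eLpNorm (fun p : ℝ × EuclideanSpace ℝ (Fin 3) =>
            ∫ t' in (0 : ℝ)..p.1,
              ∫ ξ : EuclideanSpace ℝ (Fin 3),
                Complex.exp (Complex.I *
                  Complex.ofReal (⟪p.2, ξ⟫ + sgn * (p.1 - t') * N * pStrat ξ)) *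
                  fourierTf (fun x => f (t', x)) ξ) 6 volume
          ≤ ENNReal.ofReal (C * N ^ (-(1 / 6) : ℝ) *
              ∫ t' : ℝ, sobolevNorm 1 (fun x => f (t', x))) := by
  exact final_est

end
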